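/- Let E ⊂ ℝ be a closed set. Suppose that μ_s(E) = 0 for every μ ∈ R₀(E), where R₀(E) = {μ ∈ R(E) : μ(ℝ∖E) = 0}. Then ν_s(E) = 0 for every ν ∈ R(E). -/

import Mathlib

open MeasureTheory Filter Topology

/-- The Herglotz function associated with a positive Borel measure `μ` on `ℝ`
(satisfying `∫ dμ(t)/(t²+1) < ∞`) and constants `a ∈ ℝ`, `b ≥ 0`:
`F(z) = a + b z + ∫ (1/(t - z) - t/(t² + 1)) dμ(t)`. -/
noncomputable def herglotzFn (μ : Measure ℝ) (a b : ℝ) (z : ℂ) : ℂ :=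
  (a : ℂ) + (b : ℂ) * z +
    ∫ t : ℝ, (((t : ℂ) - z)⁻¹ - (t : ℂ) / ((t : ℂ) ^ 2 + 1)) ∂μ

/-- `μ ∈ R(E)`: the measure `μ` satisfies `∫ dμ(t)/(t²+1) < ∞` and for some choice of
`a ∈ ℝ`, `b ≥ 0` the associated Herglotz function `F_μ` is reflectionless on `E`, i.e.
its boundary value has vanishing real part at Lebesgue-a.e. point of `E`. -/
def IsReflectionless (μ : Measure ℝ) (E : Set ℝ) : Prop :=
  Integrable (fun t : ℝ => (t ^ 2 + 1)⁻¹) μ ∧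
  ∃ a b : ℝ, 0 ≤ b ∧
    ∀ᵐ t : ℝ ∂(volume.restrict E),
      Tendsto (fun y : ℝ => (herglotzFn μ a b ((t : ℂ) + y * Complex.I)).re)
        (𝓝[>] (0 : ℝ)) (𝓝 0)

/-! ### The Cayley transform and the Herglotz kernel on the circle -/

open Complex in
lemma ofReal_add_I_ne_zero (t : ℝ) : (t : ℂ) + I ≠ 0 := by
  intro h
  have := congrArg Complex.im h
  simp at this

/-- The Borel `σ`-algebra on the circle. -/
noncomputable instance circleMeasurableSpace : MeasurableSpace Circle := borel _

instance circleBorelSpace : BorelSpace Circle := ⟨rfl⟩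

/-- The Cayley transform `t ↦ (t - i) / (t + i)` from the line to the circle. -/
noncomputable def cay (t : ℝ) : Circle :=
  Circle.ofConjDivSelf ((t : ℂ) + Complex.I) (ofReal_add_I_ne_zero t)

/-- The inverse of the Cayley transform. -/
noncomputable def tau (ζ : Circle) : ℝ := (ζ : ℂ).im / ((ζ : ℂ).re - 1)

/-- The Herglotz kernel of the upper half plane, parametrised by the circle. -/
noncomputable def hker (z : ℂ) (ζ : Circle) : ℂ :=
  Complex.I * ((ζ : ℂ) * (z + Complex.I) + (z - Complex.I)) /
    ((ζ : ℂ) * (z + Complex.I) - (z - Complex.I))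

lemma continuous_circle_coe : Continuous ((↑) : Circle → ℂ) := continuous_subtype_val

lemma isInducing_circle_coe : IsInducing ((↑) : Circle → ℂ) := IsInducing.subtypeVal

lemma coe_cay (t : ℝ) : (cay t : ℂ) = ((t : ℂ) - Complex.I) / ((t : ℂ) + Complex.I) := by
  simp [cay, Circle.ofConjDivSelf, sub_eq_add_neg]

lemma coe_cay' (t : ℝ) : (cay t : ℂ) =
    (((t ^ 2 - 1) / (t ^ 2 + 1) : ℝ) : ℂ) + ((-2 * t / (t ^ 2 + 1) : ℝ) : ℂ) * Complex.I := by
  have h2 : (t : ℂ) ^ 2 + 1 ≠ 0 := by exact_mod_cast (by positivity : t ^ 2 + 1 ≠ 0)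
  have h := ofReal_add_I_ne_zero t
  rw [coe_cay]
  push_cast
  rw [div_eq_iff h]
  field_simp
  linear_combination (2 * (t : ℂ)) * Complex.I_sq

lemma cay_re (t : ℝ) : (cay t : ℂ).re = (t ^ 2 - 1) / (t ^ 2 + 1) := by
  rw [coe_cay', Complex.add_re, Complex.re_ofReal_mul, Complex.ofReal_re]; simp

lemma cay_im (t : ℝ) : (cay t : ℂ).im = -2 * t / (t ^ 2 + 1) := by
  rw [coe_cay', Complex.add_im, Complex.im_ofReal_mul, Complex.ofReal_im]; simp

lemma cay_ne_one (t : ℝ) : cay t ≠ 1 := by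
  intro h
  have h1 := cay_re t
  rw [h, eq_div_iff (by positivity)] at h1
  simp at h1
  linarith

lemma tau_cay (t : ℝ) : tau (cay t) = t := by
  have h : t ^ 2 + 1 ≠ 0 := by positivity
  rw [tau, cay_re, cay_im]
  have : (t ^ 2 - 1) / (t ^ 2 + 1) - 1 = -2 / (t ^ 2 + 1) := by field_simp; ring
  rw [this]
  field_simp

lemma circle_re_sq_add_im_sq (ζ : Circle) : (ζ : ℂ).re ^ 2 + (ζ : ℂ).im ^ 2 = 1 := by
  have := Circle.normSq_coe ζ
  rw [Complex.normSq_apply] at this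
  nlinarith

lemma circle_re_ne_one {ζ : Circle} (h : ζ ≠ 1) : (ζ : ℂ).re - 1 ≠ 0 := by
  intro h1
  apply h
  have h2 := circle_re_sq_add_im_sq ζ
  have h3 : (ζ : ℂ).re = 1 := by linarith
  apply Circle.ext
  apply Complex.ext
  · simpa using h3
  · rw [h3] at h2
    have : (ζ : ℂ).im ^ 2 = 0 := by linarith
    simpa using this

lemma cay_tau {ζ : Circle} (h : ζ ≠ 1) : cay (tau ζ) = ζ := by
  have h1 := circle_re_ne_one h
  have h2 := circle_re_sq_add_im_sq ζ
  set x := (ζ : ℂ).re with hx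
  set y := (ζ : ℂ).im with hy
  have key : tau ζ ^ 2 + 1 = -2 / (x - 1) := by
    rw [tau, ← hx, ← hy]; field_simp; nlinarith
  apply Circle.ext
  apply Complex.ext
  · rw [cay_re, show tau ζ ^ 2 - 1 = (tau ζ ^ 2 + 1) - 2 by ring, key, ← hx]
    field_simp; ring
  · rw [cay_im, key, ← hy, tau, ← hx, ← hy]
    field_simp

lemma eq_one_or_eq_cay (ζ : Circle) : ζ = 1 ∨ ∃ t, ζ = cay t := by
  by_cases h : ζ = 1
  · exact Or.inl h
  · exact Or.inr ⟨tau ζ, (cay_tau h).symm⟩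

lemma continuous_cay : Continuous cay := by
  apply isInducing_circle_coe.continuous_iff.mpr
  have : ((↑) : Circle → ℂ) ∘ cay = fun t : ℝ => ((t : ℂ) - Complex.I) / ((t : ℂ) + Complex.I) := by
    ext t; exact coe_cay t
  rw [this]
  exact Continuous.div (by fun_prop) (by fun_prop) ofReal_add_I_ne_zero

lemma measurable_tau : Measurable tau := by
  have h : Measurable ((↑) : Circle → ℂ) := continuous_circle_coe.measurable
  unfold tau
  fun_prop

lemma normSq_ofReal_sub (t : ℝ) (z : ℂ) :
    Complex.normSq ((t : ℂ) - z) = (t - z.re) ^ 2 + z.im ^ 2 := by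
  rw [Complex.normSq_apply]; simp; ring

lemma ofReal_sub_ne_zero {z : ℂ} (hz : 0 < z.im) (t : ℝ) : (t : ℂ) - z ≠ 0 := by
  intro h
  have := congrArg Complex.im h
  simp at this
  linarith

lemma norm_sub_I_lt {z : ℂ} (hz : 0 < z.im) : ‖z - Complex.I‖ < ‖z + Complex.I‖ := by
  rw [← sq_lt_sq₀ (norm_nonneg _) (norm_nonneg _), ← Complex.normSq_eq_norm_sq,
    ← Complex.normSq_eq_norm_sq, Complex.normSq_apply, Complex.normSq_apply]
  simp
  nlinarith

lemma le_norm_hker_denom (z : ℂ) (ζ : Circle) :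
    ‖z + Complex.I‖ - ‖z - Complex.I‖ ≤
      ‖(ζ : ℂ) * (z + Complex.I) - (z - Complex.I)‖ := by
  have := norm_sub_norm_le ((ζ : ℂ) * (z + Complex.I)) (z - Complex.I)
  rwa [norm_mul, Circle.norm_coe, one_mul] at this

lemma hker_denom_ne_zero {z : ℂ} (hz : 0 < z.im) (ζ : Circle) :
    (ζ : ℂ) * (z + Complex.I) - (z - Complex.I) ≠ 0 := by
  rw [← norm_pos_iff]
  have := le_norm_hker_denom z ζ
  have := norm_sub_I_lt hz
  linarith

lemma hker_one (z : ℂ) : hker z 1 = z := by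
  simp only [hker, Circle.coe_one]
  have : (1 : ℂ) * (z + Complex.I) - (z - Complex.I) = 2 * Complex.I := by ring
  rw [this, div_eq_iff (by simp)]
  ring

lemma hker_cay {z : ℂ} (hz : 0 < z.im) (t : ℝ) :
    hker z (cay t) = (1 + t * z) / (t - z) := by
  have h1 := hker_denom_ne_zero hz (cay t)
  have h2 := ofReal_sub_ne_zero hz t
  have h3 := ofReal_add_I_ne_zero t
  have hmul : (cay t : ℂ) * ((t : ℂ) + Complex.I) = t - Complex.I := by
    rw [coe_cay]; field_simp
  rw [hker, div_eq_div_iff h1 h2]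
  apply mul_right_cancel₀ h3
  linear_combination (Complex.I * (z + Complex.I) * (t - z) - (1 + t * z) * (z + Complex.I)) * hmul
    + 2 * Complex.I * (z - t) * Complex.I_sq

lemma hker_cay' {z : ℂ} (hz : 0 < z.im) (t : ℝ) :
    hker z (cay t) = (t ^ 2 + 1) * ((t - z)⁻¹ - t / ((t : ℂ) ^ 2 + 1)) := by
  have h2 := ofReal_sub_ne_zero hz t
  have h3 : (t : ℂ) ^ 2 + 1 ≠ 0 := by exact_mod_cast (by positivity : t ^ 2 + 1 ≠ 0)
  rw [hker_cay hz]
  field_simp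
  ring

lemma hker_I (ζ : Circle) : hker Complex.I ζ = Complex.I := by
  have h : (ζ : ℂ) ≠ 0 := Circle.coe_ne_zero ζ
  simp [hker]

lemma im_one_add_mul_div {z : ℂ} (t : ℝ) :
    ((1 + t * z) / (t - z)).im = (t ^ 2 + 1) * z.im / Complex.normSq (t - z) := by
  rw [Complex.div_im]
  simp
  ring

lemma hker_im_pos {z : ℂ} (hz : 0 < z.im) (ζ : Circle) : 0 < (hker z ζ).im := by
  rcases eq_one_or_eq_cay ζ with rfl | ⟨t, rfl⟩
  · rwa [hker_one]
  · rw [hker_cay hz, im_one_add_mul_div]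
    have := Complex.normSq_pos.mpr (ofReal_sub_ne_zero hz t)
    positivity

lemma continuous_hker {z : ℂ} (hz : 0 < z.im) : Continuous (hker z) := by
  unfold hker
  have : Continuous ((↑) : Circle → ℂ) := continuous_circle_coe
  exact Continuous.div (by fun_prop) (by fun_prop) (hker_denom_ne_zero hz)

lemma hasDerivAt_hker {z : ℂ} (hz : 0 < z.im) (ζ : Circle) :
    HasDerivAt (fun w => hker w ζ)
      (-4 * ζ / ((ζ : ℂ) * (z + Complex.I) - (z - Complex.I)) ^ 2) z := by
  have h := hker_denom_ne_zero hz ζ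
  have h1 : HasDerivAt (fun z : ℂ => Complex.I * ((ζ : ℂ) * (z + Complex.I) + (z - Complex.I)))
      (Complex.I * (ζ * 1 + 1)) z :=
    ((((hasDerivAt_id z).add_const _).const_mul _).add ((hasDerivAt_id z).sub_const _)).const_mul _
  have h2 : HasDerivAt (fun z : ℂ => ((ζ : ℂ) * (z + Complex.I) - (z - Complex.I)))
      (ζ * 1 - 1) z :=
    ((((hasDerivAt_id z).add_const _).const_mul _).sub ((hasDerivAt_id z).sub_const _))
  refine (h1.div h2 h).congr_deriv ?_
  congr 1
  linear_combination (4 * (ζ : ℂ)) * Complex.I_sq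

/-! ### Herglotz functions of finite measures on the circle -/

/-- The Herglotz function of a measure on the circle. -/
noncomputable def HF (ρ : Measure Circle) (z : ℂ) : ℂ := ∫ ζ, hker z ζ ∂ρ

lemma integrable_hker (ρ : Measure Circle) [IsFiniteMeasure ρ] {z : ℂ} (hz : 0 < z.im) :
    Integrable (hker z) ρ :=
  (continuous_hker hz).integrable_of_hasCompactSupport (HasCompactSupport.of_compactSpace _)

lemma HF_I (ρ : Measure Circle) [IsFiniteMeasure ρ] :
    HF ρ Complex.I = ρ.real Set.univ * Complex.I := by
  simp [HF, hker_I]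

lemma HF_add (ρ σ : Measure Circle) [IsFiniteMeasure ρ] [IsFiniteMeasure σ] {z : ℂ}
    (hz : 0 < z.im) : HF (ρ + σ) z = HF ρ z + HF σ z :=
  integral_add_measure (integrable_hker ρ hz) (integrable_hker σ hz)

lemma HF_im (ρ : Measure Circle) [IsFiniteMeasure ρ] {z : ℂ} (hz : 0 < z.im) :
    (HF ρ z).im = ∫ ζ, (hker z ζ).im ∂ρ :=
  (integral_im (integrable_hker ρ hz)).symm

lemma HF_im_nonneg (ρ : Measure Circle) [IsFiniteMeasure ρ] {z : ℂ} (hz : 0 < z.im) :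
    0 ≤ (HF ρ z).im := by
  rw [HF_im ρ hz]
  exact integral_nonneg fun ζ => (hker_im_pos hz ζ).le

lemma HF_differentiableAt (ρ : Measure Circle) [IsFiniteMeasure ρ] {z : ℂ} (hz : 0 < z.im) :
    DifferentiableAt ℂ (HF ρ) z := by
  set g : ℂ → ℝ := fun w => ‖w + Complex.I‖ - ‖w - Complex.I‖ with hg
  have hgc : Continuous g := by fun_prop
  have hgz : 0 < g z := sub_pos.mpr (norm_sub_I_lt hz)
  set s : Set ℂ := {w | 0 < w.im} ∩ {w | g z / 2 < g w} with hs
  have hso : IsOpen s :=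
    (isOpen_lt continuous_const Complex.continuous_im).inter (isOpen_lt continuous_const hgc)
  have hzs : z ∈ s := ⟨hz, by simp only [Set.mem_ofPred_eq]; linarith⟩
  refine (hasDerivAt_integral_of_dominated_loc_of_deriv_le (μ := ρ) (F := fun w ζ => hker w ζ)
    (F' := fun w ζ => -4 * (ζ : ℂ) / ((ζ : ℂ) * (w + Complex.I) - (w - Complex.I)) ^ 2)
    (bound := fun _ => 4 / (g z / 2) ^ 2) (s := s) (hso.mem_nhds hzs)
    ?_ (integrable_hker ρ hz) ?_ ?_ (integrable_const _) ?_).2.differentiableAt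
  · filter_upwards [hso.mem_nhds hzs] with w hw
    exact (integrable_hker ρ hw.1).aestronglyMeasurable
  · have hc := continuous_circle_coe
    refine (Continuous.div (by fun_prop) (by fun_prop) fun ζ => ?_).aestronglyMeasurable
    exact pow_ne_zero _ (hker_denom_ne_zero hz ζ)
  · refine Eventually.of_forall fun ζ w hw => ?_
    rw [norm_div, norm_mul, Circle.norm_coe, norm_pow]
    have h1 : g z / 2 ≤ ‖(ζ : ℂ) * (w + Complex.I) - (w - Complex.I)‖ :=
      hw.2.le.trans (le_norm_hker_denom w ζ)
    have h0 : 0 < g z / 2 := by linarith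
    simp only [norm_neg, Complex.norm_ofNat, mul_one]
    gcongr
  · exact Eventually.of_forall fun ζ w hw => hasDerivAt_hker hw.1 ζ

/-! ### Passing between measures on the line and on the circle -/

/-- The measure on the line corresponding to a measure on the circle. -/
noncomputable def lineMeasure (ρ : Measure Circle) : Measure ℝ :=
  ((ρ.restrict {1}ᶜ).map tau).withDensity fun t => ENNReal.ofReal (t ^ 2 + 1)

/-- The measure on the circle corresponding to a measure on the line and a mass at infinity. -/
noncomputable def circleMeasure (κ : Measure ℝ) (b : ℝ) : Measure Circle :=
  (κ.withDensity fun t => ENNReal.ofReal (t ^ 2 + 1)⁻¹).map cay + ENNReal.ofReal b • Measure.dirac 1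

lemma measurable_weight : Measurable fun t : ℝ => ENNReal.ofReal (t ^ 2 + 1) := by fun_prop

lemma measurable_weight_inv : Measurable fun t : ℝ => ENNReal.ofReal (t ^ 2 + 1)⁻¹ := by fun_prop

lemma integrable_weight_iff (κ : Measure ℝ) :
    Integrable (fun t : ℝ => (t ^ 2 + 1)⁻¹) κ ↔
      ∫⁻ t, ENNReal.ofReal (t ^ 2 + 1)⁻¹ ∂κ < ⊤ := by
  have hm : AEStronglyMeasurable (fun t : ℝ => (t ^ 2 + 1)⁻¹) κ :=
    (by fun_prop : Measurable fun t : ℝ => (t ^ 2 + 1)⁻¹).aestronglyMeasurable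
  constructor
  · intro h
    exact (hasFiniteIntegral_iff_ofReal (Eventually.of_forall fun t => by positivity)).1 h.2
  · intro h
    exact ⟨hm, (hasFiniteIntegral_iff_ofReal (Eventually.of_forall fun t => by positivity)).2 h⟩

lemma integrable_weight_lineMeasure (ρ : Measure Circle) [IsFiniteMeasure ρ] :
    Integrable (fun t : ℝ => (t ^ 2 + 1)⁻¹) (lineMeasure ρ) := by
  rw [integrable_weight_iff, lineMeasure,
    lintegral_withDensity_eq_lintegral_mul _ measurable_weight measurable_weight_inv]
  have : ∀ t : ℝ, ((fun t : ℝ => ENNReal.ofReal (t ^ 2 + 1)) *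
      fun t : ℝ => ENNReal.ofReal (t ^ 2 + 1)⁻¹) t = 1 := by
    intro t
    rw [Pi.mul_apply, ← ENNReal.ofReal_mul (by positivity), mul_inv_cancel₀ (by positivity),
      ENNReal.ofReal_one]
  simp only [this, lintegral_one]
  exact measure_lt_top _ _

lemma isFiniteMeasure_circleMeasure {κ : Measure ℝ} (b : ℝ)
    (hκ : Integrable (fun t : ℝ => (t ^ 2 + 1)⁻¹) κ) : IsFiniteMeasure (circleMeasure κ b) := by
  have : IsFiniteMeasure (κ.withDensity fun t => ENNReal.ofReal (t ^ 2 + 1)⁻¹) :=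
    isFiniteMeasure_withDensity ((integrable_weight_iff κ).1 hκ).ne
  have : IsFiniteMeasure (ENNReal.ofReal b • (Measure.dirac 1 : Measure Circle)) :=
    Measure.smul_finite _ ENNReal.ofReal_ne_top
  unfold circleMeasure
  infer_instance

lemma herglotzFn_lineMeasure (ρ : Measure Circle) [IsFiniteMeasure ρ] (a : ℝ) {z : ℂ}
    (hz : 0 < z.im) :
    herglotzFn (lineMeasure ρ) a (ρ.real {1}) z = a + HF ρ z := by
  have h1 : ∫ ζ in {1}, hker z ζ ∂ρ = ρ.real {1} * z := by
    rw [integral_singleton, hker_one]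
    simp
  have hms : MeasurableSet ({1} : Set Circle) := (isClosed_singleton).measurableSet
  have hg : Measurable fun t : ℝ => (((t : ℂ) - z)⁻¹ - (t : ℂ) / ((t : ℂ) ^ 2 + 1)) := by fun_prop
  have h2 : ∫ t : ℝ, (((t : ℂ) - z)⁻¹ - (t : ℂ) / ((t : ℂ) ^ 2 + 1)) ∂(lineMeasure ρ) =
      ∫ ζ in {1}ᶜ, hker z ζ ∂ρ := by
    rw [lineMeasure, integral_withDensity_eq_integral_toReal_smul measurable_weight
      (Eventually.of_forall fun t => ENNReal.ofReal_lt_top),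
      integral_map measurable_tau.aemeasurable (by
        refine Measurable.aestronglyMeasurable ?_
        fun_prop)]
    refine setIntegral_congr_fun hms.compl fun ζ hζ => ?_
    have := hker_cay' hz (tau ζ)
    rw [cay_tau hζ] at this
    rw [this, ENNReal.toReal_ofReal (by positivity)]
    simp
  rw [herglotzFn, h2, HF, ← integral_add_compl hms (integrable_hker ρ hz), h1]
  ring

lemma HF_circleMeasure {κ : Measure ℝ} {b : ℝ} (hb : 0 ≤ b)
    (hκ : Integrable (fun t : ℝ => (t ^ 2 + 1)⁻¹) κ) {z : ℂ} (hz : 0 < z.im) :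
    HF (circleMeasure κ b) z = herglotzFn κ 0 b z := by
  have : IsFiniteMeasure (κ.withDensity fun t => ENNReal.ofReal (t ^ 2 + 1)⁻¹) :=
    isFiniteMeasure_withDensity ((integrable_weight_iff κ).1 hκ).ne
  have : IsFiniteMeasure (ENNReal.ofReal b • (Measure.dirac 1 : Measure Circle)) :=
    Measure.smul_finite _ ENNReal.ofReal_ne_top
  unfold circleMeasure
  rw [HF_add _ _ hz, herglotzFn]
  have h1 : HF (ENNReal.ofReal b • (Measure.dirac 1 : Measure Circle)) z = b * z := by
    rw [HF, integral_smul_measure, integral_dirac, hker_one, ENNReal.toReal_ofReal hb]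
    simp
  have h2 : HF ((κ.withDensity fun t => ENNReal.ofReal (t ^ 2 + 1)⁻¹).map cay) z =
      ∫ t : ℝ, (((t : ℂ) - z)⁻¹ - (t : ℂ) / ((t : ℂ) ^ 2 + 1)) ∂κ := by
    rw [HF, integral_map continuous_cay.measurable.aemeasurable
      (continuous_hker hz).aestronglyMeasurable,
      integral_withDensity_eq_integral_toReal_smul measurable_weight_inv
      (Eventually.of_forall fun t => ENNReal.ofReal_lt_top)]
    refine integral_congr_ae (Eventually.of_forall fun t => ?_)
    simp only
    have h3 : (t : ℂ) ^ 2 + 1 ≠ 0 := by exact_mod_cast (by positivity : t ^ 2 + 1 ≠ 0)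
    rw [hker_cay' hz, ENNReal.toReal_ofReal (by positivity), Complex.real_smul]
    push_cast
    rw [inv_mul_cancel_left₀ h3]
  rw [h1, h2]
  simp [add_comm]

/-! ### The Herglotz representation theorem -/

lemma exists_measure_circle_integral_eq (g : Circle → ℝ) (hg : Continuous g) (hg0 : ∀ ζ, 0 ≤ g ζ) :
    ∃ ρ : Measure Circle, IsFiniteMeasure ρ ∧ ∀ φ : Circle → ℝ, Continuous φ →
      ∫ ζ, φ ζ ∂ρ = (2 * Real.pi)⁻¹ * ∫ θ in (0)..(2 * Real.pi),
        φ (Circle.exp θ) * g (Circle.exp θ) := by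
  set d : ℝ → ℝ := fun θ => (2 * Real.pi)⁻¹ * g (Circle.exp θ) with hd
  have hdc : Continuous d := by fun_prop
  have hd0 : ∀ θ, 0 ≤ d θ := fun θ => mul_nonneg (by positivity) (hg0 _)
  have hdm : Measurable fun θ => ENNReal.ofReal (d θ) := by fun_prop
  set m : Measure ℝ := volume.restrict (Set.Ioc 0 (2 * Real.pi)) with hm
  have hint : Integrable d m :=
    (hdc.integrableOn_Icc (a := 0) (b := 2 * Real.pi)).mono_set Set.Ioc_subset_Icc_self
  have hfin : IsFiniteMeasure (m.withDensity fun θ => ENNReal.ofReal (d θ)) :=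
    isFiniteMeasure_withDensity_ofReal hint.2
  refine ⟨(m.withDensity fun θ => ENNReal.ofReal (d θ)).map Circle.exp, inferInstance,
    fun φ hφ => ?_⟩
  rw [integral_map Circle.exp.continuous.measurable.aemeasurable hφ.aestronglyMeasurable,
    integral_withDensity_eq_integral_toReal_smul hdm
      (Eventually.of_forall fun t => ENNReal.ofReal_lt_top),
    intervalIntegral.integral_of_le (by positivity), ← integral_const_mul]
  refine integral_congr_ae (Eventually.of_forall fun θ => ?_)
  simp only [hd]
  rw [ENNReal.toReal_ofReal (hd0 θ), smul_eq_mul]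
  ring

lemma cayley_disc_im {w : ℂ} (hw : ‖w‖ < 1) : 0 < (Complex.I * (1 + w) / (1 - w)).im := by
  have h1 : (1 : ℂ) - w ≠ 0 := by
    intro h
    rw [← sub_eq_zero.mp h] at hw
    simp at hw
  have h2 : w.re ^ 2 + w.im ^ 2 < 1 := by
    have : Complex.normSq w < 1 := by
      rw [Complex.normSq_eq_norm_sq]
      nlinarith [norm_nonneg w]
    rw [Complex.normSq_apply] at this
    nlinarith
  have h3 : (Complex.I * (1 + w) / (1 - w)).im =
      (1 - (w.re ^ 2 + w.im ^ 2)) / Complex.normSq (1 - w) := by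
    rw [Complex.div_im]
    simp
    ring
  rw [h3]
  exact div_pos (by linarith) (Complex.normSq_pos.mpr h1)

lemma norm_cayley_lt_one {z : ℂ} (hz : 0 < z.im) :
    ‖(z - Complex.I) / (z + Complex.I)‖ < 1 := by
  have h := norm_sub_I_lt hz
  rw [norm_div, div_lt_one ((norm_nonneg _).trans_lt h)]
  exact h

lemma add_I_ne_zero {z : ℂ} (hz : 0 < z.im) : z + Complex.I ≠ 0 := by
  rw [← norm_pos_iff]
  exact (norm_nonneg _).trans_lt (norm_sub_I_lt hz)

lemma poissonKernel_eq_hker_im {z : ℂ} (hz : 0 < z.im) (ζ : Circle) :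
    poissonKernel 0 ((z - Complex.I) / (z + Complex.I)) ζ = (hker z ζ).im := by
  have h1 := add_I_ne_zero hz
  have h2 := hker_denom_ne_zero hz ζ
  rw [poissonKernel_eq_re_herglotzRieszKernel, Function.comp_apply, herglotzRieszKernel_def]
  have h3 : (ζ : ℂ) - 0 - ((z - Complex.I) / (z + Complex.I) - 0) =
      ((ζ : ℂ) * (z + Complex.I) - (z - Complex.I)) / (z + Complex.I) := by
    field_simp; ring
  have h4 : (ζ : ℂ) - 0 + ((z - Complex.I) / (z + Complex.I) - 0) =
      ((ζ : ℂ) * (z + Complex.I) + (z - Complex.I)) / (z + Complex.I) := by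
    field_simp; ring
  rw [h3, h4, div_div_div_cancel_right₀ h1, hker, mul_div_assoc, Complex.I_mul_im]

lemma upper_isOpen : IsOpen {z : ℂ | 0 < z.im} := isOpen_lt continuous_const Complex.continuous_im

lemma exists_measure_poisson {F : ℂ → ℂ} (hd : ∀ z : ℂ, 0 < z.im → DifferentiableAt ℂ F z)
    (him : ∀ z : ℂ, 0 < z.im → 0 ≤ (F z).im) {r : ℝ} (hr0 : 0 ≤ r) (hr : r < 1) :
    ∃ ρ : Measure Circle, IsFiniteMeasure ρ ∧ ∀ z : ℂ, 0 < z.im →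
      ∫ ζ, (hker z ζ).im ∂ρ =
        (F (Complex.I * (1 + r * ((z - Complex.I) / (z + Complex.I))) /
          (1 - r * ((z - Complex.I) / (z + Complex.I))))).im := by
  set f : ℂ → ℂ := fun w => F (Complex.I * (1 + r * w) / (1 - r * w)) with hf
  have hrw : ∀ w : ℂ, ‖w‖ ≤ 1 → ‖(r : ℂ) * w‖ < 1 := by
    intro w hw
    rw [norm_mul, Complex.norm_real, Real.norm_of_nonneg hr0]
    nlinarith [norm_nonneg w]
  have hfd : ∀ w : ℂ, ‖w‖ ≤ 1 → DifferentiableAt ℂ f w := by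
    intro w hw
    have h1 := hd _ (cayley_disc_im (hrw w hw))
    have h2 : (1 : ℂ) - r * w ≠ 0 := by
      intro h
      have h3 := hrw w hw
      rw [← sub_eq_zero.mp h] at h3
      simp at h3
    have h4 : DifferentiableAt ℂ (fun w : ℂ => Complex.I * (1 + r * w) / (1 - r * w)) w :=
      DifferentiableAt.div (by fun_prop) (by fun_prop) h2
    exact DifferentiableAt.comp (g := F) w h1 h4
  have hcl : DiffContOnCl ℂ f (Metric.ball 0 1) := by
    refine ⟨fun w hw => (hfd w ?_).differentiableWithinAt, fun w hw => ?_⟩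
    · simpa using (mem_ball_zero_iff.mp hw).le
    · rw [closure_ball _ one_ne_zero] at hw
      exact (hfd w (by simpa using hw)).continuousAt.continuousWithinAt
  have hgc : Continuous fun ζ : Circle => (f ζ).im := by
    refine Complex.continuous_im.comp (continuous_iff_continuousAt.mpr fun ζ => ?_)
    exact ContinuousAt.comp (g := f) (hfd ζ (Circle.norm_coe ζ).le).continuousAt
      continuous_circle_coe.continuousAt
  obtain ⟨ρ, hρ, h⟩ := exists_measure_circle_integral_eq (fun ζ : Circle => (f ζ).im) hgc
    (fun ζ => him _ (cayley_disc_im (hrw _ (Circle.norm_coe ζ).le)))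
  refine ⟨ρ, hρ, fun z hz => ?_⟩
  rw [h (fun ζ => (hker z ζ).im) (Complex.continuous_im.comp (continuous_hker hz))]
  have hP := hcl.circleAverage_poissonKernel_smul
    (w := (z - Complex.I) / (z + Complex.I)) (by simpa using norm_cayley_lt_one hz)
  change _ = (f _).im
  rw [← hP, Real.circleAverage_def, Complex.smul_im, smul_eq_mul]
  congr 1
  have hc : ∀ θ : ℝ, circleMap 0 1 θ = Circle.exp θ := by
    intro θ; simp [circleMap]
  simp only [Pi.smul_apply', hc, poissonKernel_eq_hker_im hz]
  have hi : IntervalIntegrable (fun θ : ℝ => (hker z (Circle.exp θ)).im • f (Circle.exp θ))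
      volume 0 (2 * Real.pi) := by
    refine Continuous.intervalIntegrable ?_ _ _
    have h1 : Continuous fun ζ : Circle => f ζ :=
      continuous_iff_continuousAt.mpr fun ζ => ContinuousAt.comp (g := f)
        (hfd ζ (Circle.norm_coe ζ).le).continuousAt continuous_circle_coe.continuousAt
    exact ((Complex.continuous_im.comp (continuous_hker hz)).smul h1).comp Circle.exp.continuous
  have := Complex.imCLM.intervalIntegral_comp_comm hi
  simp only [Complex.imCLM_apply, Complex.smul_im, smul_eq_mul] at this
  exact this

lemma eq_of_im_eq_zero {g : ℂ → ℂ} (hd : ∀ z : ℂ, 0 < z.im → DifferentiableAt ℂ g z)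
    (him : ∀ z : ℂ, 0 < z.im → (g z).im = 0) {z w : ℂ} (hz : 0 < z.im) (hw : 0 < w.im) :
    g z = g w := by
  have hne : ∀ z : ℂ, 0 < z.im → g z + Complex.I ≠ 0 := by
    intro z hz h
    have := congrArg Complex.im h
    simp [him z hz] at this
  have hn : ∀ z : ℂ, 0 < z.im → ‖(g z - Complex.I) / (g z + Complex.I)‖ = 1 := by
    intro z hz
    rw [norm_div, div_eq_one_iff_eq (norm_ne_zero_iff.mpr (hne z hz)),
      ← sq_eq_sq₀ (norm_nonneg _) (norm_nonneg _), ← Complex.normSq_eq_norm_sq,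
      ← Complex.normSq_eq_norm_sq, Complex.normSq_apply, Complex.normSq_apply]
    simp [him z hz]
  have h := Complex.eqOn_of_isPreconnected_of_isMaxOn_norm
    (f := fun z => (g z - Complex.I) / (g z + Complex.I))
    (convex_halfSpace_im_gt 0).isPreconnected upper_isOpen
    (fun z hz => (((hd z hz).sub_const _).div ((hd z hz).add_const _)
      (hne z hz)).differentiableWithinAt) hw (fun x hx => by
        simp only [Set.mem_ofPred_eq, Function.comp_apply]
        rw [hn x hx, hn w hw])
  have h1 := h hz
  simp only [Function.const_apply] at h1
  rw [div_eq_div_iff (hne z hz) (hne w hw)] at h1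
  have h2 : 2 * Complex.I * (g z - g w) = 0 := by linear_combination h1
  simpa [sub_eq_zero] using h2

/-- The **Herglotz representation theorem**. -/
theorem exists_herglotz_representation {F : ℂ → ℂ}
    (hd : ∀ z : ℂ, 0 < z.im → DifferentiableAt ℂ F z)
    (him : ∀ z : ℂ, 0 < z.im → 0 ≤ (F z).im) :
    ∃ ρ : Measure Circle, IsFiniteMeasure ρ ∧
      ∀ z : ℂ, 0 < z.im → F z = (F Complex.I).re + HF ρ z := by
  have hI : 0 < Complex.I.im := by simp
  set r : ℕ → ℝ := fun n => 1 - 1 / ((n : ℝ) + 1) with hr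
  have hr0 : ∀ n, 0 ≤ r n := by
    intro n
    have : 1 / ((n : ℝ) + 1) ≤ 1 := by
      rw [div_le_one (by positivity)]; linarith [(Nat.cast_nonneg n : (0 : ℝ) ≤ n)]
    simp only [hr]; linarith
  have hr1 : ∀ n, r n < 1 := by
    intro n
    have : 0 < 1 / ((n : ℝ) + 1) := by positivity
    simp only [hr]; linarith
  have hrt : Tendsto r atTop (𝓝 1) := by
    simpa [hr] using (tendsto_const_nhds (x := (1 : ℝ))).sub
      (tendsto_one_div_add_atTop_nhds_zero_nat (𝕜 := ℝ))
  choose ρ hρ h using fun n => exists_measure_poisson hd him (hr0 n) (hr1 n)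
  set m : ℕ → FiniteMeasure Circle := fun n => ⟨ρ n, hρ n⟩ with hm
  have hmass : ∀ n, (m n).mass ≤ (F Complex.I).im.toNNReal := by
    intro n
    have h1 := h n Complex.I hI
    simp only [hker_I, Complex.I_im, sub_self, zero_div, mul_zero, add_zero, sub_zero,
      mul_one, div_one] at h1
    rw [integral_const, smul_eq_mul, mul_one] at h1
    rw [← h1]
    exact (Real.toNNReal_coe (r := ((ρ n) Set.univ).toNNReal)).ge
  have hK := isCompact_setOfPred_finiteMeasure_le_of_compactSpace Circle (F Complex.I).im.toNNReal
  set U : Ultrafilter ℕ := hyperfilter ℕ with hU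
  have hUle : (U : Filter ℕ) ≤ atTop := Nat.hyperfilter_le_atTop
  obtain ⟨μ, -, hμ⟩ := hK.ultrafilter_le_nhds' (U.map m)
    (Eventually.of_forall (f := (U : Filter ℕ)) hmass)
  have hμt : Tendsto m U (𝓝 μ) := hμ
  refine ⟨(μ : Measure Circle), inferInstance, ?_⟩
  have key : ∀ z : ℂ, 0 < z.im → (HF μ z).im = (F z).im := by
    intro z hz
    rw [HF_im _ hz]
    set φ : BoundedContinuousFunction Circle ℝ := BoundedContinuousFunction.mkOfCompact
      ⟨fun ζ => (hker z ζ).im, Complex.continuous_im.comp (continuous_hker hz)⟩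
    have h1 := (FiniteMeasure.tendsto_iff_forall_integral_tendsto.mp hμt) φ
    set c := (z - Complex.I) / (z + Complex.I) with hc
    have hc1 : (1 : ℂ) - c ≠ 0 := by
      intro h
      have h3 := norm_cayley_lt_one hz
      rw [← hc, ← sub_eq_zero.mp h] at h3
      simp at h3
    have hzc : Complex.I * (1 + (1 : ℝ) * c) / (1 - (1 : ℝ) * c) = z := by
      have := add_I_ne_zero hz
      rw [div_eq_iff (by simpa using hc1), hc]
      push_cast
      field_simp
      ring
    have h2 : Tendsto (fun n => (F (Complex.I * (1 + r n * c) / (1 - r n * c))).im) atTop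
        (𝓝 (F z).im) := by
      have hcont : ContinuousAt (fun x : ℝ => Complex.I * (1 + x * c) / (1 - x * c)) 1 :=
        ContinuousAt.div (by fun_prop) (by fun_prop) (by simpa using hc1)
      have hcc : ContinuousAt
          (fun x : ℝ => (F (Complex.I * (1 + x * c) / (1 - x * c))).im) 1 := by
        refine Complex.continuous_im.continuousAt.comp ?_
        refine ContinuousAt.comp (g := F) ?_ hcont
        rw [hzc]
        exact (hd z hz).continuousAt
      have := hcc.tendsto.comp hrt
      rw [hzc] at this
      exact this
    refine tendsto_nhds_unique h1 ((h2.mono_left hUle).congr fun n => ?_)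
    exact (h n z hz).symm
  intro z hz
  have h2 := eq_of_im_eq_zero (g := fun z => F z - HF μ z)
    (fun z hz => (hd z hz).sub (HF_differentiableAt _ hz))
    (fun z hz => by simp [key z hz]) hz hI
  have h3 : F Complex.I - HF μ Complex.I = ((F Complex.I).re : ℂ) := by
    apply Complex.ext
    · rw [HF_I]; simp
    · simp [key _ hI]
  rw [← h3, ← h2]; ring

/-! ### Fatou's theorem for Poisson integrals -/

/-- The Poisson integral (without the factor `1/π`) of a measure on the line. -/
noncomputable def poissonInt (κ : Measure ℝ) (x y : ℝ) : ℝ := ∫ t, y / ((t - x) ^ 2 + y ^ 2) ∂κ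

lemma lintegral_poisson_le_of_closedBall_le {m₁ m₂ : Measure ℝ} {x y : ℝ} (hy : 0 < y)
    (h : ∀ r, 0 < r → m₁ (Metric.closedBall x r) ≤ m₂ (Metric.closedBall x r)) :
    ∫⁻ t, ENNReal.ofReal (y / ((t - x) ^ 2 + y ^ 2)) ∂m₁ ≤
      ∫⁻ t, ENNReal.ofReal (y / ((t - x) ^ 2 + y ^ 2)) ∂m₂ := by
  have hm : Measurable fun t : ℝ => y / ((t - x) ^ 2 + y ^ 2) := by fun_prop
  have h0 : ∀ t : ℝ, 0 ≤ y / ((t - x) ^ 2 + y ^ 2) := fun t => by positivity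
  rw [lintegral_eq_lintegral_meas_le _ (Eventually.of_forall h0) hm.aemeasurable,
    lintegral_eq_lintegral_meas_le _ (Eventually.of_forall h0) hm.aemeasurable]
  have hne : ∀ᵐ s : ℝ ∂volume.restrict (Set.Ioi 0), s ≠ 1 / y :=
    ae_restrict_of_ae (compl_mem_ae_iff.mpr (measure_singleton _))
  refine lintegral_mono_ae ?_
  filter_upwards [hne, ae_restrict_mem measurableSet_Ioi] with s hs hs0
  have hs0' : (0 : ℝ) < s := hs0
  have hiff : ∀ t : ℝ, s ≤ y / ((t - x) ^ 2 + y ^ 2) ↔ (t - x) ^ 2 ≤ y / s - y ^ 2 := by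
    intro t
    rw [le_div_iff₀ (by positivity), le_sub_iff_add_le, le_div_iff₀ hs0', mul_comm]
  rcases lt_trichotomy (y / s - y ^ 2) 0 with hlt | heq | hgt
  · have : {t : ℝ | s ≤ y / ((t - x) ^ 2 + y ^ 2)} = ∅ := by
      ext t
      simp only [Set.mem_ofPred_eq, hiff, Set.mem_empty_iff_false, iff_false, not_le]
      exact hlt.trans_le (sq_nonneg _)
    simp [this]
  · exfalso
    apply hs
    field_simp at heq
    field_simp
    nlinarith
  · have : {t : ℝ | s ≤ y / ((t - x) ^ 2 + y ^ 2)} =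
        Metric.closedBall x (Real.sqrt (y / s - y ^ 2)) := by
      ext t
      simp only [Set.mem_ofPred_eq, hiff, Metric.mem_closedBall, Real.dist_eq]
      rw [← sq_abs, Real.le_sqrt (abs_nonneg _) hgt.le]
    rw [this]
    exact h _ (Real.sqrt_pos.mpr hgt)

lemma poisson_le_weight {x y t δ : ℝ} (hy : 0 < y) (hδ : 0 < δ) (ht : δ < |t - x|) :
    y / ((t - x) ^ 2 + y ^ 2) ≤ y * (2 + (2 * x ^ 2 + 1) / δ ^ 2) * (t ^ 2 + 1)⁻¹ := by
  have h1 : δ ^ 2 < (t - x) ^ 2 := by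
    rw [← sq_abs (t - x)]
    gcongr
  have h2 : (2 * x ^ 2 + 1) ≤ (2 * x ^ 2 + 1) / δ ^ 2 * (t - x) ^ 2 := by
    rw [div_mul_eq_mul_div, le_div_iff₀ (by positivity)]
    gcongr
  have h3 : t ^ 2 + 1 ≤ (2 + (2 * x ^ 2 + 1) / δ ^ 2) * (t - x) ^ 2 := by
    nlinarith [sq_nonneg (t - 2 * x)]
  have h4 : t ^ 2 + 1 ≤ (2 + (2 * x ^ 2 + 1) / δ ^ 2) * ((t - x) ^ 2 + y ^ 2) := by
    have : 0 ≤ (2 + (2 * x ^ 2 + 1) / δ ^ 2) * y ^ 2 := by positivity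
    linarith
  rw [← div_eq_mul_inv, div_le_div_iff₀ (by positivity) (by positivity), mul_assoc]
  gcongr

lemma lintegral_poisson_le_of_small_closedBall_le {m₁ m₂ : Measure ℝ} {x y δ : ℝ} (hy : 0 < y)
    (hδ : 0 < δ)
    (h : ∀ r, 0 < r → r ≤ δ → m₁ (Metric.closedBall x r) ≤ m₂ (Metric.closedBall x r)) :
    ∫⁻ t, ENNReal.ofReal (y / ((t - x) ^ 2 + y ^ 2)) ∂m₁ ≤
      ∫⁻ t, ENNReal.ofReal (y / ((t - x) ^ 2 + y ^ 2)) ∂m₂ +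
      ENNReal.ofReal (y * (2 + (2 * x ^ 2 + 1) / δ ^ 2)) *
        ∫⁻ t, ENNReal.ofReal (t ^ 2 + 1)⁻¹ ∂m₁ := by
  have hms : MeasurableSet (Metric.closedBall x δ) := measurableSet_closedBall
  rw [← lintegral_add_compl _ hms]
  refine add_le_add ?_ ?_
  · refine lintegral_poisson_le_of_closedBall_le hy fun r hr => ?_
    rw [Measure.restrict_apply measurableSet_closedBall]
    rcases le_total r δ with hrδ | hrδ
    · exact (measure_mono Set.inter_subset_left).trans (h r hr hrδ)
    · exact (measure_mono Set.inter_subset_right).trans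
        ((h δ hδ le_rfl).trans (measure_mono (Metric.closedBall_subset_closedBall hrδ)))
  · rw [← lintegral_const_mul _ measurable_weight_inv]
    refine (setLIntegral_mono' hms.compl fun t ht => ?_).trans (setLIntegral_le_lintegral _ _)
    rw [← ENNReal.ofReal_mul (by positivity)]
    refine ENNReal.ofReal_le_ofReal (poisson_le_weight hy hδ ?_)
    simpa [Real.dist_eq] using ht

lemma poisson_eq_scaled {x y : ℝ} (hy : 0 < y) (t : ℝ) :
    y / ((t - x) ^ 2 + y ^ 2) = y⁻¹ * (1 + ((t - x) / y) ^ 2)⁻¹ := by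
  field_simp
  ring

lemma integrable_poisson_volume (x : ℝ) {y : ℝ} (hy : 0 < y) :
    Integrable fun t : ℝ => y / ((t - x) ^ 2 + y ^ 2) := by
  simp_rw [poisson_eq_scaled hy]
  exact (((integrable_inv_one_add_sq.comp_div hy.ne').comp_sub_right x)).const_mul _

lemma integral_poisson_volume (x : ℝ) {y : ℝ} (hy : 0 < y) :
    ∫ t : ℝ, y / ((t - x) ^ 2 + y ^ 2) = Real.pi := by
  simp_rw [poisson_eq_scaled hy]
  rw [integral_const_mul, integral_sub_right_eq_self (fun t : ℝ => (1 + (t / y) ^ 2)⁻¹) x,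
    Measure.integral_comp_div (fun t : ℝ => (1 + t ^ 2)⁻¹) y, integral_univ_inv_one_add_sq,
    smul_eq_mul, abs_of_pos hy, inv_mul_cancel_left₀ hy.ne']

lemma lintegral_poisson_volume (x : ℝ) {y : ℝ} (hy : 0 < y) :
    ∫⁻ t : ℝ, ENNReal.ofReal (y / ((t - x) ^ 2 + y ^ 2)) = ENNReal.ofReal Real.pi := by
  rw [← ofReal_integral_eq_lintegral_ofReal (integrable_poisson_volume x hy)
    (Eventually.of_forall fun t => by positivity), integral_poisson_volume x hy]

lemma integrable_weight_volume : Integrable fun t : ℝ => (t ^ 2 + 1)⁻¹ := by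
  simpa [add_comm] using integrable_inv_one_add_sq

lemma integrable_poisson {κ : Measure ℝ} (hκ : Integrable (fun t : ℝ => (t ^ 2 + 1)⁻¹) κ)
    (x : ℝ) {y : ℝ} (hy : 0 < y) : Integrable (fun t : ℝ => y / ((t - x) ^ 2 + y ^ 2)) κ := by
  refine Integrable.mono' (hκ.const_mul ((2 * y ^ 2 + 2 * x ^ 2 + 1) / y))
    (by fun_prop : Measurable fun t : ℝ => y / ((t - x) ^ 2 + y ^ 2)).aestronglyMeasurable
    (Eventually.of_forall fun t => ?_)
  rw [Real.norm_of_nonneg (by positivity), ← div_eq_mul_inv, div_div,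
    div_le_div_iff₀ (by positivity) (by positivity)]
  nlinarith [sq_nonneg (t - 2 * x), sq_nonneg (t - x), sq_nonneg y,
    mul_nonneg (sq_nonneg (t - x)) (sq_nonneg x), mul_nonneg (sq_nonneg (t - x)) (sq_nonneg y),
    mul_nonneg (sq_nonneg y) (sq_nonneg (t - 2 * x)), mul_nonneg (sq_nonneg y) (sq_nonneg y)]

lemma isLocallyFiniteMeasure_of_weight {κ : Measure ℝ}
    (hκ : Integrable (fun t : ℝ => (t ^ 2 + 1)⁻¹) κ) : IsLocallyFiniteMeasure κ := by
  refine ⟨fun x => ⟨Metric.ball x 1, Metric.ball_mem_nhds x one_pos, ?_⟩⟩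
  refine lt_of_le_of_lt (measure_mono fun t ht => ?_)
    (hκ.measure_ge_lt_top (ε := ((|x| + 1) ^ 2 + 1)⁻¹) (by positivity))
  have h1 : |t - x| < 1 := by simpa [Real.dist_eq] using ht
  have h2 : |t| ≤ |x| + 1 := by
    have := abs_sub_abs_le_abs_sub t x
    linarith
  have h3 : t ^ 2 ≤ (|x| + 1) ^ 2 := by
    rw [← sq_abs t]
    gcongr
  simp only [Set.mem_ofPred_eq]
  gcongr

lemma tendsto_poissonInt_of_density {κ : Measure ℝ}
    (hκ : Integrable (fun t : ℝ => (t ^ 2 + 1)⁻¹) κ) {x : ℝ} {d : ENNReal} (hd : d ≠ ⊤)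
    (h : Tendsto (fun r => κ (Metric.closedBall x r) / volume (Metric.closedBall x r))
      (𝓝[>] 0) (𝓝 d)) :
    Tendsto (poissonInt κ x) (𝓝[>] 0) (𝓝 (Real.pi * d.toReal)) := by
  set D := d.toReal with hD
  have hD0 : 0 ≤ D := ENNReal.toReal_nonneg
  have hdD : ENNReal.ofReal D = d := ENNReal.ofReal_toReal hd
  have hvol : ∀ r : ℝ, 0 < r → volume (Metric.closedBall x r) ≠ 0 := fun r hr =>
    (Metric.measure_closedBall_pos volume x hr).ne'
  have hvol' : ∀ r : ℝ, volume (Metric.closedBall x r) ≠ ⊤ := fun r =>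
    measure_closedBall_lt_top.ne
  have hA : ∀ y : ℝ, 0 < y → ENNReal.ofReal (poissonInt κ x y) =
      ∫⁻ t, ENNReal.ofReal (y / ((t - x) ^ 2 + y ^ 2)) ∂κ := fun y hy =>
    ofReal_integral_eq_lintegral_ofReal (integrable_poisson hκ x hy)
      (Eventually.of_forall fun t => by positivity)
  have hA0 : ∀ y : ℝ, 0 < y → 0 ≤ poissonInt κ x y := fun y hy =>
    integral_nonneg fun t => by positivity
  set W := ∫ t : ℝ, (t ^ 2 + 1)⁻¹ ∂κ with hW
  have hW0 : 0 ≤ W := integral_nonneg fun t => by positivity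
  have hWl : ENNReal.ofReal W = ∫⁻ t, ENNReal.ofReal (t ^ 2 + 1)⁻¹ ∂κ :=
    ofReal_integral_eq_lintegral_ofReal hκ (Eventually.of_forall fun t => by positivity)
  set V := ∫ t : ℝ, (t ^ 2 + 1)⁻¹ with hV
  have hV0 : 0 ≤ V := integral_nonneg fun t => by positivity
  have hVl : ENNReal.ofReal V = ∫⁻ t : ℝ, ENNReal.ofReal (t ^ 2 + 1)⁻¹ :=
    ofReal_integral_eq_lintegral_ofReal integrable_weight_volume
      (Eventually.of_forall fun t => by positivity)
  have hpi := Real.pi_pos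
  have small : ∀ C η : ℝ, 0 < η → ∀ᶠ y in 𝓝[>] (0 : ℝ), y * C < η := by
    intro C η hη
    have : Tendsto (fun y : ℝ => y * C) (𝓝[>] 0) (𝓝 (0 * C)) :=
      tendsto_nhdsWithin_of_tendsto_nhds (by fun_prop : Continuous fun y : ℝ => y * C).continuousAt
    rw [zero_mul] at this
    exact this.eventually_lt_const hη
  have exδ : ∀ p : ℝ → Prop, (∀ᶠ r in 𝓝[>] (0 : ℝ), p r) →
      ∃ δ > 0, ∀ r, 0 < r → r ≤ δ → p r := by
    intro p hp
    obtain ⟨u, hu, hsub⟩ := (mem_nhdsGT_iff_exists_Ioc_subset (a := (0 : ℝ))).mp hp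
    exact ⟨u, hu, fun r h1 h2 => hsub ⟨h1, h2⟩⟩
  refine tendsto_order.2 ⟨fun a ha => ?_, fun a ha => ?_⟩
  · obtain ⟨c, hca, hcD⟩ : ∃ c, a / Real.pi < c ∧ c < D :=
      exists_between (by rwa [div_lt_iff₀ hpi, mul_comm])
    rcases le_or_gt c 0 with hc0 | hc0
    · filter_upwards [self_mem_nhdsWithin] with y hy
      have : a < 0 := by
        have := hca.trans_le hc0
        rwa [div_lt_iff₀ hpi, zero_mul] at this
      exact this.trans_le (hA0 y hy)
    have hlt : ENNReal.ofReal c < d := by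
      rw [← hdD]; exact (ENNReal.ofReal_lt_ofReal_iff_of_nonneg hc0.le).mpr hcD
    obtain ⟨δ, hδ, hb⟩ := exδ _ (h.eventually_const_lt hlt)
    rw [div_lt_iff₀ hpi] at hca
    filter_upwards [self_mem_nhdsWithin,
      small ((2 + (2 * x ^ 2 + 1) / δ ^ 2) * (c * V)) (c * Real.pi - a) (by linarith)] with y hy hs
    have hy' : (0 : ℝ) < y := hy
    have hcmp := lintegral_poisson_le_of_small_closedBall_le (m₁ := ENNReal.ofReal c • volume)
      (m₂ := κ) (x := x) hy' hδ (fun r hr hrδ => by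
        rw [Measure.smul_apply, smul_eq_mul]
        exact ((ENNReal.lt_div_iff_mul_lt (Or.inl (hvol r hr)) (Or.inl (hvol' r))).mp
          (hb r hr hrδ)).le)
    rw [lintegral_smul_measure, lintegral_smul_measure, lintegral_poisson_volume x hy', ← hVl,
      ← hA y hy', smul_eq_mul, smul_eq_mul, ← ENNReal.ofReal_mul hc0.le,
      ← ENNReal.ofReal_mul hc0.le, ← ENNReal.ofReal_mul (by positivity),
      ← ENNReal.ofReal_add (hA0 y hy') (by positivity),
      ENNReal.ofReal_le_ofReal_iff (add_nonneg (hA0 y hy') (by positivity))] at hcmp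
    nlinarith
  · obtain ⟨c, hDc, hca⟩ : ∃ c, D < c ∧ c < a / Real.pi :=
      exists_between (by rwa [lt_div_iff₀ hpi, mul_comm])
    have hc0 : 0 < c := hD0.trans_lt hDc
    have hlt : d < ENNReal.ofReal c := by
      rw [← hdD]; exact (ENNReal.ofReal_lt_ofReal_iff_of_nonneg hD0).mpr hDc
    obtain ⟨δ, hδ, hb⟩ := exδ _ (h.eventually_lt_const hlt)
    rw [lt_div_iff₀ hpi] at hca
    filter_upwards [self_mem_nhdsWithin,
      small ((2 + (2 * x ^ 2 + 1) / δ ^ 2) * W) (a - c * Real.pi) (by linarith)] with y hy hs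
    have hy' : (0 : ℝ) < y := hy
    have hcmp := lintegral_poisson_le_of_small_closedBall_le (m₁ := κ)
      (m₂ := ENNReal.ofReal c • volume) (x := x) hy' hδ (fun r hr hrδ => by
        rw [Measure.smul_apply, smul_eq_mul]
        exact ((ENNReal.div_lt_iff (Or.inl (hvol r hr)) (Or.inl (hvol' r))).mp
          (hb r hr hrδ)).le)
    rw [lintegral_smul_measure, lintegral_poisson_volume x hy', ← hWl,
      ← hA y hy', smul_eq_mul, ← ENNReal.ofReal_mul hc0.le, ← ENNReal.ofReal_mul (by positivity),
      ← ENNReal.ofReal_add (by positivity) (by positivity),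
      ENNReal.ofReal_le_ofReal_iff (by positivity)] at hcmp
    nlinarith

/-- **Fatou's theorem**: boundary values of Poisson integrals. -/
theorem ae_tendsto_poissonInt {κ : Measure ℝ} (hκ : Integrable (fun t : ℝ => (t ^ 2 + 1)⁻¹) κ) :
    ∀ᵐ x, Tendsto (poissonInt κ x) (𝓝[>] 0) (𝓝 (Real.pi * (κ.rnDeriv volume x).toReal)) := by
  have := isLocallyFiniteMeasure_of_weight hκ
  filter_upwards [Besicovitch.ae_tendsto_rnDeriv κ volume, κ.rnDeriv_lt_top volume] with x hx hlt
  exact tendsto_poissonInt_of_density hκ hlt.ne hx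

/-! ### The argument inequality characterising reflectionless Herglotz functions -/

lemma HF_im_eq (ρ : Measure Circle) [IsFiniteMeasure ρ] {z : ℂ} (hz : 0 < z.im) :
    (HF ρ z).im = ρ.real {1} * z.im + poissonInt (lineMeasure ρ) z.re z.im := by
  have hms : MeasurableSet ({1} : Set Circle) := (isClosed_singleton).measurableSet
  have h1 : ∫ ζ in {1}, (hker z ζ).im ∂ρ = ρ.real {1} * z.im := by
    rw [integral_singleton, hker_one]
    simp
  have h2 : poissonInt (lineMeasure ρ) z.re z.im = ∫ ζ in {1}ᶜ, (hker z ζ).im ∂ρ := by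
    rw [poissonInt, lineMeasure, integral_withDensity_eq_integral_toReal_smul measurable_weight
      (Eventually.of_forall fun t => ENNReal.ofReal_lt_top),
      integral_map measurable_tau.aemeasurable (by
        refine Measurable.aestronglyMeasurable ?_
        fun_prop)]
    refine setIntegral_congr_fun hms.compl fun ζ hζ => ?_
    have := hker_cay hz (tau ζ)
    rw [cay_tau hζ] at this
    rw [this, ENNReal.toReal_ofReal (by positivity), im_one_add_mul_div, normSq_ofReal_sub,
      smul_eq_mul, mul_div_assoc]
  have hi : Integrable (fun ζ => (hker z ζ).im) ρ :=
    Complex.imCLM.integrable_comp (integrable_hker ρ hz)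
  rw [HF_im ρ hz, ← integral_add_compl hms hi, h1, h2]

lemma ae_tendsto_HF_im (ρ : Measure Circle) [IsFiniteMeasure ρ] :
    ∀ᵐ x : ℝ, Tendsto (fun y : ℝ => (HF ρ ((x : ℂ) + y * Complex.I)).im) (𝓝[>] 0)
      (𝓝 (Real.pi * ((lineMeasure ρ).rnDeriv volume x).toReal)) := by
  filter_upwards [ae_tendsto_poissonInt (integrable_weight_lineMeasure ρ)] with x hx
  have h1 : Tendsto (fun y : ℝ => ρ.real {1} * y) (𝓝[>] 0) (𝓝 (ρ.real {1} * 0)) :=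
    tendsto_nhdsWithin_of_tendsto_nhds
      (by fun_prop : Continuous fun y : ℝ => ρ.real {1} * y).continuousAt
  have h2 := h1.add hx
  rw [mul_zero, zero_add] at h2
  refine h2.congr' ?_
  filter_upwards [self_mem_nhdsWithin] with y hy
  rw [HF_im_eq ρ (by simpa using hy)]
  simp

/-- The Poisson integral of half the indicator function of the complement of `E`. -/
noncomputable def psi (E : Set ℝ) (z : ℂ) : ℝ :=
  (1 / 2) * poissonInt (volume.restrict Eᶜ) z.re z.im

lemma poissonInt_nonneg (κ : Measure ℝ) (x : ℝ) {y : ℝ} (hy : 0 < y) : 0 ≤ poissonInt κ x y :=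
  integral_nonneg fun t => by positivity

lemma psi_nonneg (E : Set ℝ) {z : ℂ} (hz : 0 < z.im) : 0 ≤ psi E z :=
  mul_nonneg (by norm_num) (poissonInt_nonneg _ _ hz)

lemma poissonInt_restrict_add_compl {E : Set ℝ} (hE : MeasurableSet E) (x : ℝ) {y : ℝ}
    (hy : 0 < y) :
    poissonInt (volume.restrict E) x y + poissonInt (volume.restrict Eᶜ) x y = Real.pi := by
  rw [poissonInt, poissonInt, integral_add_compl hE (integrable_poisson_volume x hy),
    integral_poisson_volume x hy]

lemma psi_le {E : Set ℝ} (hE : MeasurableSet E) {z : ℂ} (hz : 0 < z.im) :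
    psi E z ≤ Real.pi / 2 := by
  have h1 := poissonInt_restrict_add_compl hE z.re hz
  have h2 := poissonInt_nonneg (volume.restrict E) z.re hz
  unfold psi
  linarith

lemma psi_lt {E : Set ℝ} (hE : MeasurableSet E) (hpos : volume E ≠ 0) {z : ℂ} (hz : 0 < z.im) :
    psi E z < Real.pi / 2 := by
  have h1 := poissonInt_restrict_add_compl hE z.re hz
  have h2 : 0 < poissonInt (volume.restrict E) z.re z.im := by
    unfold poissonInt
    rw [integral_pos_iff_support_of_nonneg (fun t => by positivity)
      (integrable_poisson_volume z.re hz).restrict]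
    have : (Function.support fun t : ℝ => z.im / ((t - z.re) ^ 2 + z.im ^ 2)) = Set.univ := by
      ext t
      simp only [Function.mem_support, Set.mem_univ, iff_true]
      positivity
    rw [this, Measure.restrict_apply_univ]
    exact pos_iff_ne_zero.mpr hpos
  unfold psi
  linarith

lemma ae_tendsto_psi {E : Set ℝ} (hE : MeasurableSet E) :
    ∀ᵐ t : ℝ ∂(volume.restrict E),
      Tendsto (fun y : ℝ => psi E ((t : ℂ) + y * Complex.I)) (𝓝[>] 0) (𝓝 0) := by
  rw [ae_restrict_iff' hE]
  filter_upwards [ae_tendsto_poissonInt (integrable_weight_volume.restrict (s := Eᶜ)),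
    Measure.rnDeriv_restrict_self volume hE.compl] with t ht hrn htE
  have h1 : (volume.restrict Eᶜ).rnDeriv volume t = 0 := by
    rw [hrn]; simp [htE]
  rw [h1] at ht
  simpa [psi] using ht.const_mul (2⁻¹)

lemma im_ge_of_tendsto {E : Set ℝ} (hE : MeasurableSet E) {L : ℂ → ℂ}
    (hd : ∀ z : ℂ, 0 < z.im → DifferentiableAt ℂ L z) (him : ∀ z : ℂ, 0 < z.im → 0 ≤ (L z).im)
    (hL : ∀ᵐ t : ℝ ∂(volume.restrict E), Tendsto (fun y : ℝ => (L ((t : ℂ) + y * Complex.I)).im)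
      (𝓝[>] 0) (𝓝 (Real.pi / 2))) {z : ℂ} (hz : 0 < z.im) :
    Real.pi / 2 - psi E z ≤ (L z).im := by
  obtain ⟨ρ, hρ, hrep⟩ := exists_herglotz_representation hd him
  have him' : ∀ z : ℂ, 0 < z.im → (L z).im = (HF ρ z).im := fun z hz => by rw [hrep z hz]; simp
  set κ := lineMeasure ρ with hκ
  have hloc := isLocallyFiniteMeasure_of_weight (integrable_weight_lineMeasure ρ)
  rw [ae_restrict_iff' hE] at hL
  have hle : (ENNReal.ofReal (1 / 2)) • volume.restrict E ≤ κ := by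
    refine le_trans ?_ (Measure.withDensity_rnDeriv_le κ volume)
    rw [← withDensity_const, ← withDensity_indicator hE]
    refine withDensity_mono ?_
    filter_upwards [hL, ae_tendsto_HF_im ρ, κ.rnDeriv_lt_top volume] with t ht1 ht2 hlt
    by_cases htE : t ∈ E
    · rw [Set.indicator_of_mem htE]
      have h3 := (ht1 htE).congr' (f₂ := fun y : ℝ => (HF ρ ((t : ℂ) + y * Complex.I)).im) (by
        filter_upwards [self_mem_nhdsWithin] with y hy
        exact him' _ (by simpa using hy))
      have h4 := tendsto_nhds_unique h3 ht2
      have h5 : (1 / 2 : ℝ) = (κ.rnDeriv volume t).toReal := by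
        have := Real.pi_ne_zero
        field_simp at h4 ⊢
        linarith
      rw [h5, ENNReal.ofReal_toReal hlt.ne]
    · rw [Set.indicator_of_notMem htE]
      exact zero_le
  have h6 : (1 / 2) * poissonInt (volume.restrict E) z.re z.im ≤ poissonInt κ z.re z.im := by
    have := integral_mono_measure hle (f := fun t => z.im / ((t - z.re) ^ 2 + z.im ^ 2))
      (Eventually.of_forall fun t => by positivity)
      (integrable_poisson (integrable_weight_lineMeasure ρ) _ hz)
    rw [integral_smul_measure, ENNReal.toReal_ofReal (by norm_num), smul_eq_mul] at this
    exact this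
  have h1 := poissonInt_restrict_add_compl hE z.re hz
  rw [him' z hz, HF_im_eq ρ hz]
  have : 0 ≤ ρ.real {1} * z.im := mul_nonneg measureReal_nonneg hz.le
  unfold psi
  linarith

lemma cos_bound_of_arg {w : ℂ} {p : ℝ} (hp0 : 0 ≤ p) (hp : p ≤ Real.pi / 2)
    (h1 : Real.pi / 2 - p ≤ w.arg) (h2 : Real.pi / 2 - p ≤ Real.pi - w.arg) :
    |w.re| * Real.cos p ≤ w.im * Real.sin p := by
  have hre := Complex.norm_mul_cos_arg w
  have him := Complex.norm_mul_sin_arg w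
  have hc1 : 0 ≤ Real.cos (p - w.arg) :=
    Real.cos_nonneg_of_mem_Icc ⟨by linarith, by linarith⟩
  have hc2 : Real.cos (p + w.arg) ≤ 0 :=
    Real.cos_nonpos_of_pi_div_two_le_of_le (by linarith) (by linarith)
  rw [Real.cos_sub] at hc1
  rw [Real.cos_add] at hc2
  have hcp : 0 ≤ Real.cos p := Real.cos_nonneg_of_mem_Icc ⟨by linarith, hp⟩
  have e1 := mul_nonneg (norm_nonneg w) hc1
  have e2 := mul_nonneg (norm_nonneg w) (neg_nonneg.mpr hc2)
  rcases abs_cases w.re with ⟨h, -⟩ | ⟨h, -⟩ <;> rw [h, ← hre, ← him] <;> nlinarith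

/-- A reflectionless Herglotz function satisfies the argument inequality. -/
theorem arg_ineq_of_reflectionless {E : Set ℝ} (hE : MeasurableSet E) {F : ℂ → ℂ}
    (hd : ∀ z : ℂ, 0 < z.im → DifferentiableAt ℂ F z) (him : ∀ z : ℂ, 0 < z.im → 0 ≤ (F z).im)
    (hF : ∀ᵐ t : ℝ ∂(volume.restrict E), Tendsto (fun y : ℝ => (F ((t : ℂ) + y * Complex.I)).re)
      (𝓝[>] 0) (𝓝 0)) {z : ℂ} (hz : 0 < z.im) :
    |(F z).re| * Real.cos (psi E z) ≤ (F z).im * Real.sin (psi E z) := by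
  have main : ∀ δ : ℝ, 0 < δ →
      |(F z).re| * Real.cos (psi E z) ≤ ((F z).im + δ) * Real.sin (psi E z) := by
    intro δ hδ
    set G : ℂ → ℂ := fun z => F z + δ * Complex.I with hG
    have hGim : ∀ z : ℂ, 0 < z.im → δ ≤ (G z).im := by
      intro z hz
      have := him z hz
      simp [hG, this]
    have hGre : ∀ z : ℂ, (G z).re = (F z).re := fun z => by simp [hG]
    have hslit : ∀ z : ℂ, 0 < z.im → G z ∈ Complex.slitPlane := fun z hz =>
      Complex.mem_slitPlane_iff.mpr (Or.inr (hδ.trans_le (hGim z hz)).ne')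
    have hlog : ∀ z : ℂ, 0 < z.im → DifferentiableAt ℂ (fun z => Complex.log (G z)) z :=
      fun z hz => ((hd z hz).add_const _).clog (hslit z hz)
    have harg : ∀ᵐ t : ℝ ∂(volume.restrict E),
        Tendsto (fun y : ℝ => (G ((t : ℂ) + y * Complex.I)).arg) (𝓝[>] 0) (𝓝 (Real.pi / 2)) := by
      filter_upwards [hF] with t ht
      have h1 : Tendsto (fun y : ℝ => (G ((t : ℂ) + y * Complex.I)).re /
          ‖G ((t : ℂ) + y * Complex.I)‖) (𝓝[>] 0) (𝓝 0) := by
        have h2 : Tendsto (fun y : ℝ => |(F ((t : ℂ) + y * Complex.I)).re| / δ) (𝓝[>] 0)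
            (𝓝 0) := by
          simpa using ht.abs.div_const δ
        refine squeeze_zero_norm' ?_ h2
        filter_upwards [self_mem_nhdsWithin] with y hy
        have h3 := hGim ((t : ℂ) + y * Complex.I) (by simpa using hy)
        have h4 := (le_abs_self _).trans (Complex.abs_im_le_norm (G ((t : ℂ) + y * Complex.I)))
        rw [norm_div, Real.norm_eq_abs, norm_norm, hGre]
        gcongr
        exact h3.trans h4
      have h5 := (Real.continuous_arccos.tendsto 0).comp h1
      rw [Real.arccos_zero] at h5
      refine h5.congr' ?_
      filter_upwards [self_mem_nhdsWithin] with y hy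
      have h3 := hGim ((t : ℂ) + y * Complex.I) (by simpa using hy)
      exact (Complex.arg_of_im_pos (hδ.trans_le h3)).symm
    have b1 := im_ge_of_tendsto hE hlog (fun z hz => by
      rw [Complex.log_im, Complex.arg_nonneg_iff]
      exact hδ.le.trans (hGim z hz)) (by simpa only [Complex.log_im] using harg) hz
    have b2 := im_ge_of_tendsto hE (L := fun z => Real.pi * Complex.I - Complex.log (G z))
      (fun z hz => (hlog z hz).const_sub _) (fun z hz => by
        have := Complex.arg_le_pi (G z)
        simpa [Complex.log_im] using this) (by
        filter_upwards [harg] with t ht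
        have := ht.const_sub Real.pi
        rw [show Real.pi - Real.pi / 2 = Real.pi / 2 by ring] at this
        simpa [Complex.log_im] using this) hz
    rw [Complex.log_im] at b1
    have b2' : Real.pi / 2 - psi E z ≤ Real.pi - (G z).arg := by
      simpa [Complex.log_im] using b2
    have := cos_bound_of_arg (psi_nonneg E hz) (psi_le hE hz) b1 b2'
    simpa [hG] using this
  have hlim : Tendsto (fun δ : ℝ => ((F z).im + δ) * Real.sin (psi E z)) (𝓝[>] 0)
      (𝓝 (((F z).im + 0) * Real.sin (psi E z))) :=
    tendsto_nhdsWithin_of_tendsto_nhds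
      (by fun_prop : Continuous fun δ : ℝ => ((F z).im + δ) * Real.sin (psi E z)).continuousAt
  rw [add_zero] at hlim
  exact ge_of_tendsto hlim (by filter_upwards [self_mem_nhdsWithin] with δ hδ using main δ hδ)

/-- The argument inequality implies that the Herglotz function is reflectionless. -/
theorem reflectionless_of_arg_ineq {E : Set ℝ} (hE : MeasurableSet E) (a : ℝ)
    (ρ : Measure Circle) [IsFiniteMeasure ρ]
    (h : ∀ z : ℂ, 0 < z.im → |((a : ℂ) + HF ρ z).re| * Real.cos (psi E z) ≤
      ((a : ℂ) + HF ρ z).im * Real.sin (psi E z)) :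
    ∀ᵐ t : ℝ ∂(volume.restrict E),
      Tendsto (fun y : ℝ => ((a : ℂ) + HF ρ ((t : ℂ) + y * Complex.I)).re) (𝓝[>] 0) (𝓝 0) := by
  filter_upwards [ae_tendsto_psi hE, ae_restrict_of_ae (ae_tendsto_HF_im ρ)] with t h1 h2
  have hc := (Real.continuous_cos.tendsto 0).comp h1
  have hs := (Real.continuous_sin.tendsto 0).comp h1
  rw [Real.cos_zero] at hc
  rw [Real.sin_zero] at hs
  have h3 := (h2.mul hs).div hc one_ne_zero
  rw [mul_zero, zero_div] at h3
  refine squeeze_zero_norm' ?_ h3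
  filter_upwards [self_mem_nhdsWithin, hc.eventually_const_lt one_pos] with y hy hcy
  have h4 := h ((t : ℂ) + y * Complex.I) (by simpa using hy)
  simp only [Function.comp_apply, Pi.div_apply] at hcy ⊢
  rw [Real.norm_eq_abs, le_div_iff₀ hcy]
  refine h4.trans_eq ?_
  simp

/-! ### Sweeping mass out of a gap -/

lemma sweep_numerator_im_nonneg (a b : ℝ) {s : ℝ} (hs : 0 < s) {w : ℂ} (hu : 0 < w.re)
    (hn : 0 < w.im) :
    0 ≤ ((-(1 + a ^ 2) / w + (1 + a * b) * (s - w) + (1 + b ^ 2) * s * w ^ 2) / (s + w) : ℂ).im := by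
  obtain ⟨u, n⟩ := w
  simp only at hu hn
  set N : ℂ := -(1 + a ^ 2) / (⟨u, n⟩ : ℂ) + (1 + a * b) * (s - ⟨u, n⟩) +
    (1 + b ^ 2) * s * (⟨u, n⟩ : ℂ) ^ 2 with hN
  set ρ := u ^ 2 + n ^ 2 with hρ
  have hρ0 : 0 < ρ := by positivity
  have hNre : N.re = -(1 + a ^ 2) * u / ρ + (1 + a * b) * (s - u) +
      (1 + b ^ 2) * s * (u ^ 2 - n ^ 2) := by
    simp [hN, Complex.div_re, Complex.normSq_apply, pow_two, hρ]
  have hNim : N.im = (1 + a ^ 2) * n / ρ - (1 + a * b) * n +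
      (1 + b ^ 2) * s * (2 * u * n) := by
    simp [hN, Complex.div_im, Complex.normSq_apply, pow_two, hρ]
    ring
  have hD : Complex.normSq ((s : ℂ) + ⟨u, n⟩) = (s + u) ^ 2 + n ^ 2 := by
    simp [Complex.normSq_apply, pow_two]
  have : (N / ((s : ℂ) + ⟨u, n⟩)).im =
      n * (s * ((1 - ρ) ^ 2 + (a - b * ρ) ^ 2) / ρ + 2 * u * (1 + a ^ 2) / ρ +
        2 * u * s ^ 2 * (1 + b ^ 2)) / ((s + u) ^ 2 + n ^ 2) := by
    rw [Complex.div_im, hD, hNre, hNim, ← sub_div]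
    congr 1
    simp only [Complex.add_re, Complex.add_im, Complex.ofReal_re, Complex.ofReal_im]
    field_simp
    rw [hρ]
    ring
  rw [this]
  positivity

/-- The swept kernel. -/
lemma sweep_kernel_identity {a b p s : ℝ} {z w : ℂ} (hab : a < b) (hs : 0 < s)
    (hw0 : w ≠ 0) (hsw : (s : ℂ) - w ≠ 0) (hsw' : (s : ℂ) + w ≠ 0)
    (hz : w ^ 2 * (b - z) = z - a) (hp : s ^ 2 * (b - p) = p - a)
    (hpz : (p : ℂ) - z ≠ 0) :
    (b - a) * ((1 + p * z) / (p - z) +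
      (s * (b - p)) * ((1 + p * z) / (p - z) - z) / ((z - b) * w)) =
      (-(1 + a ^ 2) / w + (1 + a * b) * (s - w) + (1 + b ^ 2) * s * w ^ 2) / (s + w) := by
  have hba : (b : ℂ) - a ≠ 0 := by
    rw [← Complex.ofReal_sub]; exact_mod_cast (sub_pos.mpr hab).ne'
  have hw1 : 1 + w ^ 2 ≠ 0 := by
    intro h
    apply hba
    linear_combination -hz + (b - z) * h
  have hs1 : 1 + (s : ℂ) ^ 2 ≠ 0 := by exact_mod_cast (by positivity : 1 + s ^ 2 ≠ 0)
  have hz' : z = (a + b * w ^ 2) / (1 + w ^ 2) := by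
    rw [eq_div_iff hw1]; linear_combination -hz
  have hpc : (s : ℂ) ^ 2 * (b - p) = p - a := by exact_mod_cast hp
  have hp' : (p : ℂ) = (a + b * s ^ 2) / (1 + s ^ 2) := by
    rw [eq_div_iff hs1]; linear_combination -hpc
  have h1 : (p : ℂ) - z = (b - a) * (s - w) * (s + w) / ((1 + s ^ 2) * (1 + w ^ 2)) := by
    rw [hz', hp']; field_simp; ring
  have h2 : z - b = -(b - a) / (1 + w ^ 2) := by
    rw [hz']; field_simp; ring
  have h3 : (b : ℂ) - p = (b - a) / (1 + s ^ 2) := by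
    rw [hp']; field_simp; ring
  have h4 : (1 + p * z) / (p - z) - z = (1 + z ^ 2) / (p - z) := by
    field_simp; ring
  have h5 : 1 + p * z = ((1 + a ^ 2) + (1 + a * b) * (s ^ 2 + w ^ 2) +
      (1 + b ^ 2) * s ^ 2 * w ^ 2) / ((1 + s ^ 2) * (1 + w ^ 2)) := by
    rw [hz', hp']; field_simp; ring
  have h6 : 1 + z ^ 2 = ((1 + a ^ 2) + 2 * (1 + a * b) * w ^ 2 +
      (1 + b ^ 2) * w ^ 4) / (1 + w ^ 2) ^ 2 := by
    rw [hz']; field_simp; ring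
  rw [h4, h6, h5, h1, h2, h3]
  field_simp
  ring

/-- A square root of `(z - a) / (z - b)`, analytic in the upper half plane. -/
noncomputable def gapRoot (a b : ℝ) (z : ℂ) : ℂ := Complex.exp (Complex.log ((z - a) / (z - b)) / 2)

lemma sub_ofReal_ne_zero {z : ℂ} (hz : 0 < z.im) (t : ℝ) : z - (t : ℂ) ≠ 0 := by
  rw [← neg_ne_zero, neg_sub]; exact ofReal_sub_ne_zero hz t

lemma gapRoot_sq {a b : ℝ} {z : ℂ} (hz : 0 < z.im) :
    gapRoot a b z ^ 2 = (z - a) / (z - b) := by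
  rw [gapRoot, ← Complex.exp_nat_mul]
  push_cast
  rw [mul_div_cancel₀ _ two_ne_zero, Complex.exp_log]
  exact div_ne_zero (sub_ofReal_ne_zero hz a) (sub_ofReal_ne_zero hz b)

lemma gap_quotient_im_neg {a b : ℝ} (hab : a < b) {z : ℂ} (hz : 0 < z.im) :
    ((z - a) / (z - b)).im < 0 := by
  have h := Complex.normSq_pos.mpr (sub_ofReal_ne_zero hz b)
  have : ((z - a) / (z - b)).im = -((b - a) * z.im) / Complex.normSq (z - b) := by
    rw [Complex.div_im]
    simp
    ring
  rw [this]
  exact div_neg_of_neg_of_pos (by nlinarith) h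

lemma gapRoot_re_pos_im_neg {a b : ℝ} (hab : a < b) {z : ℂ} (hz : 0 < z.im) :
    0 < (gapRoot a b z).re ∧ (gapRoot a b z).im < 0 := by
  have h1 := Complex.arg_neg_iff.mpr (gap_quotient_im_neg hab hz)
  have h2 := Complex.neg_pi_lt_arg ((z - a) / (z - b))
  have him : (Complex.log ((z - a) / (z - b)) / 2).im = ((z - a) / (z - b)).arg / 2 := by
    simp [Complex.log_im]
  rw [gapRoot, Complex.exp_re, Complex.exp_im, him]
  refine ⟨mul_pos (Real.exp_pos _) (Real.cos_pos_of_mem_Ioo ⟨by linarith, by linarith⟩), ?_⟩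
  exact mul_neg_of_pos_of_neg (Real.exp_pos _)
    (Real.sin_neg_of_neg_of_neg_pi_lt (by linarith) (by linarith))

lemma gapRoot_ne_zero (a b : ℝ) (z : ℂ) : gapRoot a b z ≠ 0 := Complex.exp_ne_zero _

lemma gapRoot_differentiableAt {a b : ℝ} (hab : a < b) {z : ℂ} (hz : 0 < z.im) :
    DifferentiableAt ℂ (gapRoot a b) z := by
  have h1 : DifferentiableAt ℂ (fun z : ℂ => (z - a) / (z - b)) z :=
    DifferentiableAt.div (by fun_prop) (by fun_prop) (sub_ofReal_ne_zero hz b)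
  exact ((h1.clog (Complex.mem_slitPlane_iff.mpr
    (Or.inr (gap_quotient_im_neg hab hz).ne))).div_const 2).cexp

/-- The swept kernel has nonnegative imaginary part. -/
lemma sweep_kernel_im_nonneg {x₀ r p : ℝ} (hr : 0 < r) (hp : p ∈ Set.Icc (x₀ - r) (x₀ + r))
    {z : ℂ} (hz : 0 < z.im) :
    0 ≤ ((1 + p * z) / (p - z) + r * ((1 + p * z) / (p - z) - z) /
      ((z - (x₀ + 2 * r : ℝ)) * (Complex.I * gapRoot (x₀ - 2 * r) (x₀ + 2 * r) z))).im := by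
  set a := x₀ - 2 * r with ha
  set b := x₀ + 2 * r with hb
  set w := Complex.I * gapRoot a b z with hw
  have hab : a < b := by linarith
  obtain ⟨hre, him⟩ := gapRoot_re_pos_im_neg hab hz
  have hwre : 0 < w.re := by rw [hw, Complex.I_mul_re]; linarith
  have hwim : 0 < w.im := by rwa [hw, Complex.I_mul_im]
  have hpa : r ≤ p - a := by linarith [hp.1]
  have hbp : r ≤ b - p := by linarith [hp.2]
  set s := Real.sqrt ((p - a) / (b - p)) with hs
  have hq : 0 < (p - a) / (b - p) := div_pos (by linarith) (by linarith)
  have hs0 : 0 < s := Real.sqrt_pos.mpr hq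
  have hs2 : s ^ 2 * (b - p) = p - a := by
    rw [hs, Real.sq_sqrt hq.le, div_mul_cancel₀ _ (by linarith)]
  have hR : r ≤ s * (b - p) := by
    rw [← sq_le_sq₀ hr.le (mul_nonneg hs0.le (by linarith)), mul_pow, pow_two (b - p), ← mul_assoc,
      hs2, pow_two]
    exact mul_le_mul hpa hbp hr.le (by linarith)
  have hzb := sub_ofReal_ne_zero hz b
  have hz2 : w ^ 2 * (b - z) = z - a := by
    rw [hw, mul_pow, gapRoot_sq hz, Complex.I_sq]
    field_simp
    ring
  have him_ne : ∀ c : ℂ, c.im ≠ 0 → c ≠ 0 := fun c hc h => hc (by rw [h]; simp)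
  have hid := sweep_kernel_identity hab hs0 (him_ne w hwim.ne')
    (him_ne _ (by simpa using hwim.ne')) (him_ne _ (by simpa using hwim.ne')) hz2 hs2
    (ofReal_sub_ne_zero hz p)
  have hN := sweep_numerator_im_nonneg a b hs0 hwre hwim
  rw [← hid] at hN
  have hK : 0 < ((1 + p * z) / (p - z)).im := by
    rw [im_one_add_mul_div]
    have := Complex.normSq_pos.mpr (ofReal_sub_ne_zero hz p)
    positivity
  set k := (1 + p * z) / (p - z) with hk
  set c := (k - z) / ((z - b) * w) with hc
  have e1 : (r : ℂ) * (k - z) / ((z - b) * w) = (r : ℂ) * c := by rw [hc, mul_div_assoc]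
  have e2 : (s : ℂ) * (b - p) * (k - z) / ((z - b) * w) = ((s * (b - p) : ℝ) : ℂ) * c := by
    rw [hc, mul_div_assoc]; push_cast; ring
  rw [e2, ← Complex.ofReal_sub, Complex.im_ofReal_mul, Complex.add_im,
    Complex.im_ofReal_mul] at hN
  rw [e1, Complex.add_im, Complex.im_ofReal_mul]
  have hN' : 0 ≤ k.im + s * (b - p) * c.im := nonneg_of_mul_nonneg_right hN (by linarith)
  rcases le_or_gt 0 c.im with h | h
  · positivity
  · nlinarith

lemma one_add_mul_div_sub {z : ℂ} (hz : 0 < z.im) (p : ℝ) :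
    (1 + p * z) / (p - z) - z = (1 + z ^ 2) * ((p : ℂ) - z)⁻¹ := by
  have := ofReal_sub_ne_zero hz p
  field_simp
  ring

lemma integral_mul_inv_pos {m : Measure ℝ} [IsFiniteMeasure m] {x₀ r t : ℝ} (hr : 0 < r)
    (hm : ∀ᵐ p ∂m, p ∈ Set.Icc (x₀ - r) (x₀ + r)) (hm0 : m ≠ 0)
    (ht : t ∉ Set.Icc (x₀ - 2 * r) (x₀ + 2 * r)) :
    0 < -((∫ p, (p - t)⁻¹ ∂m) * (t - (x₀ + 2 * r))) := by
  have hf : ∀ᵐ p ∂m, 0 < -((p - t)⁻¹ * (t - (x₀ + 2 * r))) := by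
    filter_upwards [hm] with p hp
    rw [Set.mem_Icc, not_and_or, not_le, not_le] at ht
    rw [neg_pos]
    rcases ht with h | h
    · exact mul_neg_of_pos_of_neg (inv_pos.mpr (by linarith [hp.1])) (by linarith)
    · exact mul_neg_of_neg_of_pos (inv_lt_zero.mpr (by linarith [hp.2])) (by linarith)
  have hint : Integrable (fun p : ℝ => (p - t)⁻¹) m := by
    refine Integrable.of_bound (by fun_prop) r⁻¹ ?_
    filter_upwards [hm] with p hp
    rw [norm_inv, Real.norm_eq_abs]
    refine inv_anti₀ hr ?_
    rw [Set.mem_Icc, not_and_or, not_le, not_le] at ht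
    rcases ht with h | h
    · exact (by linarith [hp.1] : r ≤ p - t).trans (le_abs_self _)
    · exact (by linarith [hp.2] : r ≤ -(p - t)).trans (neg_le_abs _)
  rw [← integral_mul_const, ← integral_neg]
  refine (integral_nonneg_of_ae (hf.mono fun _ h => h.le)).lt_of_ne fun h => hm0 ?_
  have h0 := (integral_eq_zero_iff_of_nonneg_ae (hf.mono fun _ h => h.le)
    (hint.mul_const _).neg).mp h.symm
  rw [← ae_eq_bot, ← eventually_false_iff_eq_bot]
  filter_upwards [hf, h0] with p h1 h2
  exact h1.ne' h2

lemma tendsto_cauchy_boundary {m : Measure ℝ} [IsFiniteMeasure m] {x₀ r t : ℝ} (hr : 0 < r)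
    (hm : ∀ᵐ p ∂m, p ∈ Set.Icc (x₀ - r) (x₀ + r))
    (ht : t ∉ Set.Icc (x₀ - 2 * r) (x₀ + 2 * r)) :
    Tendsto (fun y : ℝ => ∫ p : ℝ, ((p : ℂ) - (t + y * Complex.I))⁻¹ ∂m) (𝓝[>] 0)
      (𝓝 ((∫ p, (p - t)⁻¹ ∂m : ℝ) : ℂ)) := by
  have hd : ∀ p ∈ Set.Icc (x₀ - r) (x₀ + r), r ≤ |p - t| := fun p hp => by
    rw [Set.mem_Icc, not_and_or, not_le, not_le] at ht
    rcases ht with h | h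
    · exact (by linarith [hp.1] : r ≤ p - t).trans (le_abs_self _)
    · exact (by linarith [hp.2] : r ≤ -(p - t)).trans (neg_le_abs _)
  rw [← integral_complex_ofReal]
  refine tendsto_integral_filter_of_dominated_convergence (fun _ => r⁻¹) ?_ ?_
    (integrable_const _) ?_
  · exact Eventually.of_forall fun y => Measurable.aestronglyMeasurable (by fun_prop)
  · refine Eventually.of_forall fun y => ?_
    filter_upwards [hm] with p hp
    rw [norm_inv]
    refine inv_anti₀ hr ((hd p hp).trans ?_)
    have := Complex.abs_re_le_norm ((p : ℂ) - (t + y * Complex.I))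
    simpa using this
  · filter_upwards [hm] with p hp
    have hne : (p : ℂ) - t ≠ 0 := by
      have h : p - t ≠ 0 := fun h => by
        have := hd p hp
        rw [h, abs_zero] at this
        linarith
      exact_mod_cast h
    have hc : ContinuousAt (fun y : ℝ => ((p : ℂ) - (t + y * Complex.I))⁻¹) 0 := by
      refine ContinuousAt.inv₀ (by fun_prop) (by simpa using hne)
    have := hc.tendsto.mono_left (nhdsWithin_le_nhds (s := Set.Ioi 0))
    simpa using this

lemma tendsto_gapRoot_boundary {a b t : ℝ} (hab : a < b) (ht : t ∉ Set.Icc a b) :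
    Tendsto (fun y : ℝ => gapRoot a b (t + y * Complex.I)) (𝓝[>] 0)
      (𝓝 (Real.exp (Real.log ((t - a) / (t - b)) / 2) : ℝ)) := by
  have hq : 0 < (t - a) / (t - b) := by
    rw [Set.mem_Icc, not_and_or, not_le, not_le] at ht
    rcases ht with h | h
    · exact div_pos_of_neg_of_neg (by linarith) (by linarith)
    · exact div_pos (by linarith) (by linarith)
  have hne : (t : ℂ) - b ≠ 0 := by
    have h : t - b ≠ 0 := fun h => by rw [h, div_zero] at hq; exact hq.false
    exact_mod_cast h
  have hc : ContinuousAt (fun y : ℝ => gapRoot a b (t + y * Complex.I)) 0 := by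
    unfold gapRoot
    refine ((ContinuousAt.clog ?_ ?_).div_const 2).cexp
    · exact ContinuousAt.div (by fun_prop) (by fun_prop) (by simpa using hne)
    · simp only [Complex.ofReal_zero, zero_mul, add_zero]
      have : ((t : ℂ) - a) / (t - b) = (((t - a) / (t - b) : ℝ) : ℂ) := by push_cast; rfl
      rw [this, Complex.ofReal_mem_slitPlane]
      exact hq
  have h := hc.tendsto.mono_left (nhdsWithin_le_nhds (s := Set.Ioi 0))
  convert h using 2
  rw [gapRoot]
  have : ((t : ℂ) - a) / (t - b) = (((t - a) / (t - b) : ℝ) : ℂ) := by push_cast; rfl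
  simp only [Complex.ofReal_zero, zero_mul, add_zero]
  rw [this, ← Complex.ofReal_log hq.le]
  push_cast
  rfl

/-- Mass near `x₀` can be moved outside `(x₀ - 2 * r, x₀ + 2 * r)` changing the Herglotz function by a
function that is imaginary outside this interval. -/
lemma exists_sweep {m : Measure ℝ} [IsFiniteMeasure m] {x₀ r : ℝ} (hr : 0 < r)
    (hm : ∀ᵐ p ∂m, p ∈ Set.Icc (x₀ - r) (x₀ + r)) (hm0 : m ≠ 0) :
    ∃ H : ℂ → ℂ, (∀ z : ℂ, 0 < z.im → DifferentiableAt ℂ H z) ∧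
      (∀ z : ℂ, 0 < z.im → 0 ≤ (H z).im) ∧ H Complex.I = m.real Set.univ * Complex.I ∧
      ∀ t ∉ Set.Icc (x₀ - 2 * r) (x₀ + 2 * r),
        Tendsto (fun y : ℝ => (H (t + y * Complex.I) -
          HF (m.map cay) (t + y * Complex.I)).re) (𝓝[>] 0) (𝓝 0) ∧
        ∃ c : ℝ, 0 < c ∧ Tendsto (fun y : ℝ => (H (t + y * Complex.I)).im) (𝓝[>] 0) (𝓝 c) := by
  set a := x₀ - 2 * r with ha
  set b := x₀ + 2 * r with hb
  have hab : a < b := by linarith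
  set K := HF (m.map cay) with hK
  set M := m.real Set.univ with hM
  have : IsFiniteMeasure (m.map cay) := Measure.isFiniteMeasure_map m cay
  have hMI : (m.map cay).real Set.univ = M := by
    rw [Measure.real, Measure.map_apply continuous_cay.measurable MeasurableSet.univ]; rfl
  have hKint : ∀ z : ℂ, 0 < z.im → Integrable (fun p : ℝ => (1 + p * z) / (p - z)) m ∧
      K z = ∫ p : ℝ, (1 + p * z) / (p - z) ∂m := fun z hz => by
    have h1 := (integrable_hker (m.map cay) hz).comp_measurable continuous_cay.measurable
    refine ⟨h1.congr (Eventually.of_forall fun p => hker_cay hz p), ?_⟩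
    rw [hK, HF, integral_map continuous_cay.measurable.aemeasurable
      (integrable_hker (m.map cay) hz).aestronglyMeasurable]
    exact integral_congr_ae (Eventually.of_forall fun p => hker_cay hz p)
  set G : ℂ → ℂ := fun z => ∫ p : ℝ, ((p : ℂ) - z)⁻¹ ∂m with hG
  have hKG : ∀ z : ℂ, 0 < z.im → K z - M * z = (1 + z ^ 2) * G z := fun z hz => by
    rw [(hKint z hz).2, hG, ← integral_const_mul]
    have : (M : ℂ) * z = ∫ _ : ℝ, z ∂m := by simp [hM]
    rw [this, ← integral_sub (hKint z hz).1 (integrable_const _)]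
    exact integral_congr_ae (Eventually.of_forall fun p => one_add_mul_div_sub hz p)
  set D : ℂ → ℂ := fun z => (z - b) * (Complex.I * gapRoot a b z) with hD
  have hD0 : ∀ z : ℂ, 0 < z.im → D z ≠ 0 := fun z hz =>
    mul_ne_zero (sub_ofReal_ne_zero hz b) (mul_ne_zero Complex.I_ne_zero (gapRoot_ne_zero a b z))
  refine ⟨fun z => K z + r * (K z - M * z) / D z, fun z hz => ?_, fun z hz => ?_, ?_, ?_⟩
  · have h1 : DifferentiableAt ℂ K z := HF_differentiableAt _ hz
    have h2 := gapRoot_differentiableAt hab hz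
    exact h1.add (DifferentiableAt.div (by fun_prop) (by fun_prop) (hD0 z hz))
  · have h1 := (hKint z hz).1
    have h2 : Integrable (fun p : ℝ => (r : ℂ) * ((1 + p * z) / (p - z) - z) / D z) m :=
      ((h1.sub (integrable_const _)).const_mul _).div_const _
    have e : K z + r * (K z - M * z) / D z =
        ∫ p : ℝ, ((1 + p * z) / (p - z) + r * ((1 + p * z) / (p - z) - z) / D z) ∂m := by
      rw [integral_add h1 h2, integral_div, integral_const_mul,
        integral_sub h1 (integrable_const _), ← (hKint z hz).2]
      simp [hM]
    change 0 ≤ (K z + r * (K z - M * z) / D z).im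
    have e2 := Complex.imCLM.integral_comp_comm (h1.add h2)
    simp only [Pi.add_apply, Complex.imCLM_apply] at e2
    rw [e, ← e2]
    refine integral_nonneg_of_ae ?_
    filter_upwards [hm] with p hp
    exact sweep_kernel_im_nonneg hr hp hz
  · have : K Complex.I = M * Complex.I := by rw [hK, HF_I, hMI]
    simp [this]
  · intro t ht
    set g := ∫ p, (p - t)⁻¹ ∂m with hg
    set e := Real.exp (Real.log ((t - a) / (t - b)) / 2) with he
    have he0 : 0 < e := Real.exp_pos _
    have hgneg : 0 < -(g * (t - b)) := integral_mul_inv_pos hr hm hm0 ht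
    have htb : t - b ≠ 0 := fun h => by rw [h] at hgneg; simp at hgneg
    have hz : Tendsto (fun y : ℝ => (t : ℂ) + y * Complex.I) (𝓝[>] 0) (𝓝 t) := by
      have hc : ContinuousAt (fun y : ℝ => (t : ℂ) + y * Complex.I) 0 := by fun_prop
      have := hc.tendsto.mono_left (nhdsWithin_le_nhds (s := Set.Ioi 0))
      simpa using this
    have hGt : Tendsto (fun y : ℝ => G (t + y * Complex.I)) (𝓝[>] 0) (𝓝 (g : ℂ)) :=
      tendsto_cauchy_boundary hr hm ht
    have hrt := tendsto_gapRoot_boundary hab ht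
    have hDt : Tendsto (fun y : ℝ => D (t + y * Complex.I)) (𝓝[>] 0)
        (𝓝 ((t - b) * (Complex.I * (e : ℂ)))) :=
      (hz.sub_const _).mul (hrt.const_mul _)
    have hDt0 : ((t : ℂ) - b) * (Complex.I * (e : ℂ)) ≠ 0 := by
      refine mul_ne_zero ?_ (mul_ne_zero Complex.I_ne_zero (by exact_mod_cast he0.ne'))
      rw [← Complex.ofReal_sub]; exact_mod_cast htb
    have hN : Tendsto (fun y : ℝ => (1 + (t + y * Complex.I) ^ 2) * G (t + y * Complex.I)) (𝓝[>] 0)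
        (𝓝 ((1 + (t : ℂ) ^ 2) * g)) := ((hz.pow 2).const_add 1).mul hGt
    set c := r * (1 + t ^ 2) * -(g * (t - b)) / ((t - b) ^ 2 * e) with hc
    have hpos : ∀ᶠ y : ℝ in 𝓝[>] 0, 0 < ((t : ℂ) + y * Complex.I).im := by
      filter_upwards [self_mem_nhdsWithin] with y hy
      simpa using hy
    have hcorr : Tendsto (fun y : ℝ => (r : ℂ) * (K (t + y * Complex.I) -
        M * (t + y * Complex.I)) / D (t + y * Complex.I)) (𝓝[>] 0) (𝓝 ((c : ℂ) * Complex.I)) := by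
      have h := (hN.const_mul (r : ℂ)).div hDt hDt0
      have e1 : (r : ℂ) * ((1 + (t : ℂ) ^ 2) * g) / (((t : ℂ) - b) * (Complex.I * e)) =
          c * Complex.I := by
        have h1 : (e : ℂ) ≠ 0 := by exact_mod_cast he0.ne'
        have h2 : (t : ℂ) - b ≠ 0 := by rw [← Complex.ofReal_sub]; exact_mod_cast htb
        rw [hc, div_eq_iff hDt0]
        push_cast
        field_simp
        rw [Complex.I_sq]
        ring
      rw [e1] at h
      refine h.congr' ?_
      filter_upwards [hpos] with y hy
      rw [Pi.div_apply, hKG _ hy]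
    have hKt : Tendsto (fun y : ℝ => K (t + y * Complex.I)) (𝓝[>] 0)
        (𝓝 (((M * t + (1 + t ^ 2) * g : ℝ)) : ℂ)) := by
      have h := (hz.const_mul (M : ℂ)).add hN
      push_cast
      refine h.congr' ?_
      filter_upwards [hpos] with y hy
      rw [← hKG _ hy]
      ring
    refine ⟨?_, c, ?_, ?_⟩
    · have := (Complex.continuous_re.tendsto _).comp hcorr
      simpa [Function.comp_def] using this
    · positivity
    · have := (Complex.continuous_im.tendsto _).comp (hKt.add hcorr)
      simpa only [Function.comp_def, Complex.add_im, Complex.ofReal_im, Complex.im_ofReal_mul,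
        Complex.I_im, mul_one, zero_add] using this

/-! ### An extremal problem -/

/-- The argument of the Herglotz function `a + HF ρ` satisfies the bound that characterises
reflectionless functions on `E`. -/
def ArgIneq (E : Set ℝ) (a : ℝ) (ρ : Measure Circle) : Prop :=
  ∀ z : ℂ, 0 < z.im → |((a : ℂ) + HF ρ z).re| * Real.cos (psi E z) ≤
    ((a : ℂ) + HF ρ z).im * Real.sin (psi E z)

lemma argIneq_iff {E : Set ℝ} (hE : MeasurableSet E) (a : ℝ) (ρ : Measure Circle)
    [IsFiniteMeasure ρ] :
    ArgIneq E a ρ ↔ ∀ᵐ t : ℝ ∂(volume.restrict E),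
      Tendsto (fun y : ℝ => ((a : ℂ) + HF ρ ((t : ℂ) + y * Complex.I)).re) (𝓝[>] 0) (𝓝 0) :=
  ⟨reflectionless_of_arg_ineq hE a ρ, fun h _ hz =>
    arg_ineq_of_reflectionless (F := fun z => (a : ℂ) + HF ρ z) hE
      (fun _ hz => (HF_differentiableAt ρ hz).const_add _)
      (fun z hz => by simpa using HF_im_nonneg ρ hz) h hz⟩

lemma continuous_HF {z : ℂ} (hz : 0 < z.im) :
    Continuous fun σ : FiniteMeasure Circle => HF (σ : Measure Circle) z := by
  have key : ∀ f : C(Circle, ℝ),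
      Continuous fun σ : FiniteMeasure Circle => ∫ ζ, f ζ ∂(σ : Measure Circle) := fun f =>
    continuous_iff_continuousAt.mpr fun σ =>
      FiniteMeasure.tendsto_iff_forall_integral_tendsto.mp tendsto_id
        (BoundedContinuousFunction.mkOfCompact f)
  have hre := key ⟨fun ζ => (hker z ζ).re, Complex.continuous_re.comp (continuous_hker hz)⟩
  have him := key ⟨fun ζ => (hker z ζ).im, Complex.continuous_im.comp (continuous_hker hz)⟩
  have e : (fun σ : FiniteMeasure Circle => HF (σ : Measure Circle) z) =
      fun σ : FiniteMeasure Circle =>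
      ((∫ ζ, (hker z ζ).re ∂(σ : Measure Circle) : ℝ) : ℂ) +
        ((∫ ζ, (hker z ζ).im ∂(σ : Measure Circle) : ℝ) : ℂ) * Complex.I := by
    funext σ
    exact (integral_re_add_im (integrable_hker (σ : Measure Circle) hz)).symm
  rw [e]
  exact (Complex.continuous_ofReal.comp hre).add
    ((Complex.continuous_ofReal.comp him).mul continuous_const)

lemma isClosed_argIneq (E : Set ℝ) (ρ₀ : Measure Circle) [IsFiniteMeasure ρ₀] :
    IsClosed {q : ℝ × FiniteMeasure Circle | ArgIneq E q.1 (ρ₀ + q.2)} := by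
  have e : {q : ℝ × FiniteMeasure Circle | ArgIneq E q.1 (ρ₀ + q.2)} =
      ⋂ (z : ℂ) (_ : 0 < z.im), {q : ℝ × FiniteMeasure Circle |
        |((q.1 : ℂ) + (HF ρ₀ z + HF (q.2 : Measure Circle) z)).re| * Real.cos (psi E z) ≤
        ((q.1 : ℂ) + (HF ρ₀ z + HF (q.2 : Measure Circle) z)).im * Real.sin (psi E z)} := by
    ext q
    simp only [Set.mem_iInter, Set.mem_ofPred_eq, ArgIneq]
    exact forall_congr' fun z => forall_congr' fun hz => by rw [HF_add _ _ hz]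
  rw [e]
  refine isClosed_iInter fun z => isClosed_iInter fun hz => ?_
  have hc : Continuous fun q : ℝ × FiniteMeasure Circle =>
      (q.1 : ℂ) + (HF ρ₀ z + HF (q.2 : Measure Circle) z) :=
    (Complex.continuous_ofReal.comp continuous_fst).add
      (continuous_const.add ((continuous_HF hz).comp continuous_snd))
  exact isClosed_le ((Complex.continuous_re.comp hc).abs.mul continuous_const)
    ((Complex.continuous_im.comp hc).mul continuous_const)

lemma ArgIneq.abs_le {E : Set ℝ} (hE : MeasurableSet E) (hpos : volume E ≠ 0) {a : ℝ}
    {ρ : Measure Circle} [IsFiniteMeasure ρ] (h : ArgIneq E a ρ) :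
    |a| ≤ ρ.real Set.univ / Real.cos (psi E Complex.I) := by
  have hI : 0 < Complex.I.im := by simp
  have hc : 0 < Real.cos (psi E Complex.I) := Real.cos_pos_of_mem_Ioo
    ⟨by linarith [psi_nonneg E hI, Real.pi_pos], psi_lt hE hpos hI⟩
  have := h Complex.I hI
  rw [HF_I] at this
  simp at this
  rw [le_div_iff₀ hc]
  exact this.trans (mul_le_of_le_one_right measureReal_nonneg (Real.sin_le_one _))

lemma exists_maximizer {E : Set ℝ} (hE : MeasurableSet E) (hpos : volume E ≠ 0)
    (ρ₀ σ₀ : Measure Circle) [IsFiniteMeasure ρ₀] [IsFiniteMeasure σ₀] {a₀ : ℝ}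
    (h₀ : ArgIneq E a₀ (ρ₀ + σ₀)) {C : Set Circle} (hC : IsClosed C) :
    ∃ (a : ℝ) (σ : Measure Circle), IsFiniteMeasure σ ∧ ArgIneq E a (ρ₀ + σ) ∧
      ∀ (a' : ℝ) (σ' : Measure Circle), σ' Set.univ ≤ σ Set.univ →
        ArgIneq E a' (ρ₀ + σ') → σ' C ≤ σ C := by
  obtain ⟨s, rfl⟩ : ∃ s : FiniteMeasure Circle, (s : Measure Circle) = σ₀ :=
    ⟨⟨σ₀, inferInstance⟩, rfl⟩
  set M : NNReal := s.mass with hM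
  set A : ℝ := (ρ₀.real Set.univ + M) / Real.cos (psi E Complex.I) with hA
  have hI : 0 < Complex.I.im := by simp
  have hc : 0 < Real.cos (psi E Complex.I) := Real.cos_pos_of_mem_Ioo
    ⟨by linarith [psi_nonneg E hI, Real.pi_pos], psi_lt hE hpos hI⟩
  set S : Set (ℝ × FiniteMeasure Circle) :=
    (Set.Icc (-A) A ×ˢ {μ : FiniteMeasure Circle | μ.mass ≤ M}) ∩
      {q | ArgIneq E q.1 (ρ₀ + q.2)} with hS
  have hcomp : IsCompact S := (isCompact_Icc.prod
    (isCompact_setOfPred_finiteMeasure_le_of_compactSpace Circle M)).inter_right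
      (isClosed_argIneq E ρ₀)
  have hmem : ∀ (a : ℝ) (σ : FiniteMeasure Circle), σ.mass ≤ M →
      ArgIneq E a (ρ₀ + σ) → (a, σ) ∈ S := fun a σ hσ h => by
    refine ⟨⟨?_, hσ⟩, h⟩
    refine abs_le.mp ((h.abs_le hE hpos).trans ?_)
    rw [hA]
    gcongr
    rw [measureReal_add_apply]
    gcongr
    exact_mod_cast hσ
  have husc : UpperSemicontinuous fun q : ℝ × FiniteMeasure Circle => (q.2 : Measure Circle) C :=
    upperSemicontinuous_iff_limsup_le.mpr fun q =>
      FiniteMeasure.limsup_measure_closed_le_of_tendsto (continuous_snd.tendsto q) hC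
  obtain ⟨⟨a, σ⟩, hq, hmax⟩ := (husc.upperSemicontinuousOn S).exists_isMaxOn
    ⟨(a₀, s), hmem _ _ le_rfl h₀⟩ hcomp
  refine ⟨a, σ, inferInstance, hq.2, fun a' σ' hm h' => ?_⟩
  have hfin : IsFiniteMeasure σ' := ⟨hm.trans_lt (measure_lt_top _ _)⟩
  obtain ⟨s', rfl⟩ : ∃ s' : FiniteMeasure Circle, (s' : Measure Circle) = σ' :=
    ⟨⟨σ', hfin⟩, rfl⟩
  refine hmax (hmem a' s' (le_trans ?_ hq.1.2) h')
  rw [← ENNReal.coe_le_coe, FiniteMeasure.ennreal_mass, FiniteMeasure.ennreal_mass]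
  exact hm

/-- The image of a subset of the line in the circle. -/
def circleSet (S : Set ℝ) : Set Circle := {1}ᶜ ∩ tau ⁻¹' S

lemma measurableSet_circleSet {S : Set ℝ} (hS : MeasurableSet S) : MeasurableSet (circleSet S) :=
  isClosed_singleton.measurableSet.compl.inter (measurable_tau hS)

lemma isOpen_circleSet {S : Set ℝ} (hS : IsOpen S) : IsOpen (circleSet S) := by
  refine ContinuousOn.isOpen_inter_preimage ?_ isClosed_singleton.isOpen_compl hS
  intro ζ hζ
  refine ContinuousAt.continuousWithinAt ?_
  exact ContinuousAt.div
    (Complex.continuous_im.comp continuous_circle_coe).continuousAt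
    ((Complex.continuous_re.comp continuous_circle_coe).sub continuous_const).continuousAt
    (circle_re_ne_one hζ)

lemma cay_mem_circleSet {S : Set ℝ} {t : ℝ} : cay t ∈ circleSet S ↔ t ∈ S := by
  simp [circleSet, cay_ne_one, tau_cay]

lemma lineMeasure_eq_zero_iff (ρ : Measure Circle) {S : Set ℝ} (hS : MeasurableSet S) :
    lineMeasure ρ S = 0 ↔ ρ (circleSet S) = 0 := by
  have h1 : ((ρ.restrict {1}ᶜ).map tau) S = ρ (circleSet S) := by
    rw [Measure.map_apply measurable_tau hS, Measure.restrict_apply (measurable_tau hS),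
      Set.inter_comm, circleSet]
  rw [← h1]
  refine ⟨fun h => ?_, fun h => withDensity_absolutelyContinuous _ _ h⟩
  refine withDensity_absolutelyContinuous' measurable_weight.aemeasurable
    (Eventually.of_forall fun t => ?_) h
  exact (ENNReal.ofReal_pos.mpr (by positivity)).ne'

lemma lineMeasure_ne_zero_of_tendsto {E : Set ℝ} (hE : MeasurableSet E) (hpos : volume E ≠ 0)
    (ρ : Measure Circle) [IsFiniteMeasure ρ]
    (h : ∀ t ∈ E, ∃ c : ℝ, 0 < c ∧
      Tendsto (fun y : ℝ => (HF ρ (t + y * Complex.I)).im) (𝓝[>] 0) (𝓝 c)) :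
    lineMeasure ρ E ≠ 0 := by
  intro h0
  have h1 : ∫⁻ t in E, (lineMeasure ρ).rnDeriv volume t = 0 :=
    le_antisymm ((Measure.setLIntegral_rnDeriv_le E).trans h0.le) zero_le
  rw [lintegral_eq_zero_iff (Measure.measurable_rnDeriv _ _)] at h1
  apply hpos
  rw [← Measure.restrict_eq_zero, ← ae_eq_bot, ← eventually_false_iff_eq_bot]
  filter_upwards [h1, ae_restrict_of_ae (ae_tendsto_HF_im ρ), ae_restrict_mem hE] with t h2 h3 h4
  obtain ⟨c, hc, hct⟩ := h t h4
  rw [h2] at h3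
  have := tendsto_nhds_unique h3 hct
  simp at this
  exact hc.ne this

lemma map_cay_restrict_map_tau (σ : Measure Circle) {J : Set ℝ} (hJ : MeasurableSet J) :
    (((σ.restrict {1}ᶜ).map tau).restrict J).map cay = σ.restrict (circleSet J) := by
  ext A hA
  have h1 := continuous_cay.measurable hA
  rw [Measure.map_apply continuous_cay.measurable hA, Measure.restrict_apply h1,
    Measure.map_apply measurable_tau (h1.inter hJ),
    Measure.restrict_apply (measurable_tau (h1.inter hJ)), Measure.restrict_apply hA]
  congr 1
  ext ζ
  simp only [circleSet, Set.mem_inter_iff, Set.mem_preimage, Set.mem_compl_iff,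
    Set.mem_singleton_iff]
  constructor
  · rintro ⟨⟨h1, h2⟩, h3⟩
    rw [cay_tau h3] at h1
    exact ⟨h1, h3, h2⟩
  · rintro ⟨h1, h2, h3⟩
    exact ⟨⟨by rwa [cay_tau h2], h3⟩, h2⟩

/-- Sweeping strictly increases the mass carried by the complement of the gaps. -/
lemma exists_better {E : Set ℝ} (hE : IsClosed E) (hpos : volume E ≠ 0)
    (ρ₀ σ : Measure Circle) [IsFiniteMeasure ρ₀] [IsFiniteMeasure σ] {a : ℝ}
    (h : ArgIneq E a (ρ₀ + σ)) (hσ : σ (circleSet Eᶜ) ≠ 0) :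
    ∃ σ' : Measure Circle, σ' Set.univ = σ Set.univ ∧ ArgIneq E a (ρ₀ + σ') ∧
      σ (circleSet Eᶜ)ᶜ < σ' (circleSet Eᶜ)ᶜ := by
  have hEm := hE.measurableSet
  set l := (σ.restrict {1}ᶜ).map tau with hl
  have hl0 : l Eᶜ ≠ 0 := by
    rwa [hl, Measure.map_apply measurable_tau hEm.compl,
      Measure.restrict_apply (measurable_tau hEm.compl), Set.inter_comm]
  obtain ⟨x₀, hx₀, hx⟩ := exists_mem_forall_mem_nhdsWithin_pos_measure hl0
  obtain ⟨ε, hε, hball⟩ := Metric.isOpen_iff.mp hE.isOpen_compl x₀ hx₀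
  set r := ε / 4 with hr
  have hr0 : 0 < r := by positivity
  have hgap : ∀ t ∈ E, t ∉ Set.Icc (x₀ - 2 * r) (x₀ + 2 * r) := fun t ht htI => by
    refine hball ?_ ht
    rw [Metric.mem_ball, Real.dist_eq, abs_lt]
    constructor <;> linarith [htI.1, htI.2]
  set J := Set.Icc (x₀ - r) (x₀ + r) with hJ
  have hJm : MeasurableSet J := measurableSet_Icc
  have hJE : J ⊆ Eᶜ := fun t ht htE =>
    hgap t htE ⟨by linarith [ht.1], by linarith [ht.2]⟩
  set m := l.restrict J with hm
  have hm0 : m ≠ 0 := by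
    rw [hm, Ne, Measure.restrict_eq_zero]
    exact (hx J (mem_nhdsWithin_of_mem_nhds
      (Icc_mem_nhds (by linarith) (by linarith)))).ne'
  have hlf : IsFiniteMeasure l := Measure.isFiniteMeasure_map _ _
  have hmc : m.map cay = σ.restrict (circleSet J) := map_cay_restrict_map_tau σ hJm
  obtain ⟨H, hHd, hHim, hHI, hHb⟩ := exists_sweep (m := m) hr0 (ae_restrict_mem hJm) hm0
  obtain ⟨τ, hτf, hτ⟩ := exists_herglotz_representation hHd hHim
  have hτH : ∀ z : ℂ, 0 < z.im → HF τ z = H z := fun z hz => by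
    rw [hτ z hz, hHI]; simp
  have hτmass : τ Set.univ = m Set.univ := by
    have h1 := hτH Complex.I (by simp)
    rw [HF_I, hHI] at h1
    have h2 := mul_right_cancel₀ Complex.I_ne_zero h1
    rw [← ENNReal.toReal_eq_toReal_iff' (measure_ne_top _ _) (measure_ne_top _ _)]
    exact_mod_cast h2
  have hJc := measurableSet_circleSet hJm
  have hsplit : σ.restrict (circleSet J)ᶜ + σ.restrict (circleSet J) = σ := by
    rw [add_comm]; exact Measure.restrict_add_restrict_compl hJc
  refine ⟨σ.restrict (circleSet J)ᶜ + τ, ?_, ?_, ?_⟩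
  · have h1 : m Set.univ = σ.restrict (circleSet J) Set.univ := by
      rw [← hmc, Measure.map_apply continuous_cay.measurable MeasurableSet.univ]; rfl
    conv_rhs => rw [← hsplit]
    rw [Measure.add_apply, Measure.add_apply, hτmass, h1]
  · rw [argIneq_iff hEm] at h ⊢
    filter_upwards [h, ae_restrict_mem hEm] with t ht htE
    have h2 := ht.add (hHb t (hgap t htE)).1
    rw [add_zero] at h2
    refine h2.congr' ?_
    filter_upwards [self_mem_nhdsWithin] with y hy
    have hz : 0 < ((t : ℂ) + y * Complex.I).im := by simpa using hy
    rw [← Complex.add_re, hmc]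
    congr 1
    conv_lhs => rw [← hsplit]
    rw [HF_add _ _ hz, HF_add _ _ hz, HF_add _ _ hz, HF_add _ _ hz, hτH _ hz, hsplit]
    ring
  · have hτE : τ (circleSet E) ≠ 0 := by
      rw [Ne, ← lineMeasure_eq_zero_iff τ hEm]
      refine lineMeasure_ne_zero_of_tendsto hEm hpos τ fun t ht => ?_
      obtain ⟨c, hc, hct⟩ := (hHb t (hgap t ht)).2
      refine ⟨c, hc, hct.congr' ?_⟩
      filter_upwards [self_mem_nhdsWithin] with y hy
      rw [hτH _ (by simpa using hy)]
    have h1 : circleSet E ⊆ (circleSet Eᶜ)ᶜ := fun ζ hζ h => h.2 hζ.2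
    have h2 : (circleSet Eᶜ)ᶜ ⊆ (circleSet J)ᶜ :=
      Set.compl_subset_compl.mpr fun ζ hζ => ⟨hζ.1, hJE hζ.2⟩
    have h3 : σ.restrict (circleSet J)ᶜ (circleSet Eᶜ)ᶜ = σ (circleSet Eᶜ)ᶜ := by
      rw [Measure.restrict_apply (measurableSet_circleSet hEm.compl).compl,
        Set.inter_eq_left.mpr h2]
    rw [Measure.add_apply, h3]
    refine ENNReal.lt_add_right (measure_ne_top _ _) fun h4 => hτE (measure_mono_null h1 h4)

lemma exists_argIneq_of_compl_null {E : Set ℝ} (hE : IsClosed E) (hpos : volume E ≠ 0)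
    (ρ₀ σ₀ : Measure Circle) [IsFiniteMeasure ρ₀] [IsFiniteMeasure σ₀] {a₀ : ℝ}
    (h₀ : ArgIneq E a₀ (ρ₀ + σ₀)) :
    ∃ (a : ℝ) (σ : Measure Circle), IsFiniteMeasure σ ∧ ArgIneq E a (ρ₀ + σ) ∧
      σ (circleSet Eᶜ) = 0 := by
  obtain ⟨a, σ, hf, h, hmax⟩ := exists_maximizer hE.measurableSet hpos ρ₀ σ₀ h₀
    (isOpen_circleSet hE.isOpen_compl).isClosed_compl
  refine ⟨a, σ, hf, h, ?_⟩
  by_contra hne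
  obtain ⟨σ', hu, h', hlt⟩ := exists_better hE hpos ρ₀ σ h hne
  exact (hmax a σ' hu.le h').not_gt hlt

lemma eq_empty_of_volume_eq_zero {E : Set ℝ} (hE : MeasurableSet E) (hnull : volume E = 0)
    (h0 : ∀ μ : Measure ℝ, IsReflectionless μ E → μ Eᶜ = 0 →
      μ.singularPart volume E = 0) : E = ∅ := by
  rw [Set.eq_empty_iff_forall_notMem]
  intro x hx
  have h1 : IsReflectionless (Measure.dirac x) E :=
    ⟨integrable_dirac (by simp), 0, 0, le_rfl, by rw [Measure.restrict_eq_zero.mpr hnull]; simp⟩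
  have h2 : (Measure.dirac x).singularPart volume = Measure.dirac x :=
    Measure.singularPart_eq_self.mpr
      (mutuallySingular_dirac x volume)
  have h3 := h0 _ h1 (by simp [hx, hE.compl])
  rw [h2] at h3
  simp [hx] at h3

lemma singularPart_apply_eq_zero {ν μ : Measure ℝ} {E : Set ℝ} (hE : MeasurableSet E)
    [ν.HaveLebesgueDecomposition volume] [μ.HaveLebesgueDecomposition volume]
    (hμ : μ.singularPart volume E = 0)
    (hac : ∀ S ⊆ E, MeasurableSet S → μ S = 0 → ν S = 0) : ν.singularPart volume E = 0 := by
  obtain ⟨T, hT, h1, h2⟩ := Measure.mutuallySingular_singularPart ν volume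
  have hs : μ (E ∩ Tᶜ) = 0 := by
    rw [Measure.haveLebesgueDecomposition_add μ volume, Measure.add_apply,
      measure_mono_null Set.inter_subset_left hμ, zero_add]
    exact withDensity_absolutelyContinuous _ _ (measure_mono_null Set.inter_subset_right h2)
  have h3 := hac _ Set.inter_subset_left (hE.inter hT.compl) hs
  rw [← nonpos_iff_eq_zero]
  calc ν.singularPart volume E
      ≤ ν.singularPart volume (E ∩ T) + ν.singularPart volume (E ∩ Tᶜ) :=
        measure_le_inter_add_sdiff _ _ _
    _ ≤ 0 + ν (E ∩ Tᶜ) := by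
        gcongr
        · exact (measure_mono_null Set.inter_subset_right h1).le
        · exact Measure.singularPart_le _ _
    _ = 0 := by rw [h3, add_zero]

lemma circleMeasure_circleSet_eq_zero_iff (κ : Measure ℝ) (b : ℝ) {S : Set ℝ}
    (hS : MeasurableSet S) : circleMeasure κ b (circleSet S) = 0 ↔ κ S = 0 := by
  have hc := measurableSet_circleSet hS
  have e : cay ⁻¹' circleSet S = S := Set.ext fun t => cay_mem_circleSet
  rw [circleMeasure, Measure.add_apply, Measure.smul_apply,
    Measure.map_apply continuous_cay.measurable hc, e, Measure.dirac_apply' _ hc]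
  have h1 : (1 : Circle) ∉ circleSet S := fun h => h.1 rfl
  rw [Set.indicator_of_notMem h1, smul_zero, add_zero]
  refine ⟨fun h => ?_, fun h => withDensity_absolutelyContinuous _ _ h⟩
  refine withDensity_absolutelyContinuous' measurable_weight_inv.aemeasurable
    (Eventually.of_forall fun t => ?_) h
  exact (ENNReal.ofReal_pos.mpr (by positivity)).ne'

lemma herglotzFn_eq_HF_add {ν : Measure ℝ} (hν : Integrable (fun t : ℝ => (t ^ 2 + 1)⁻¹) ν)
    {E : Set ℝ} (hE : MeasurableSet E) (a : ℝ) {b : ℝ} (hb : 0 ≤ b) {z : ℂ} (hz : 0 < z.im) :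
    herglotzFn ν a b z =
      a + HF (circleMeasure (ν.restrict E) 0 + circleMeasure (ν.restrict Eᶜ) b) z := by
  have hfin := isFiniteMeasure_circleMeasure b hν
  have e : circleMeasure (ν.restrict E) 0 + circleMeasure (ν.restrict Eᶜ) b =
      circleMeasure ν b := by
    rw [circleMeasure, circleMeasure, circleMeasure, ENNReal.ofReal_zero, zero_smul, add_zero,
      ← add_assoc, ← Measure.map_add _ _ continuous_cay.measurable]
    congr 2
    rw [← withDensity_add_measure, Measure.restrict_add_restrict_compl hE]
  rw [e, HF_circleMeasure hb hν hz, herglotzFn, herglotzFn]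
  push_cast
  ring

/-- Theorem 1.3: let `E ⊂ ℝ` be closed. If every `μ ∈ R₀(E)` (that is, `μ ∈ R(E)` with
`μ(Eᶜ) = 0`) has vanishing singular part on `E`, then every `ν ∈ R(E)` has vanishing
singular part on `E`. -/
theorem singular_part_vanishes_of_vanishes_for_R0
    (E : Set ℝ) (hE : IsClosed E)
    (h0 : ∀ μ : Measure ℝ, IsReflectionless μ E → μ Eᶜ = 0 →
      μ.singularPart volume E = 0) :
    ∀ ν : Measure ℝ, IsReflectionless ν E → ν.singularPart volume E = 0 := by
  rintro ν ⟨hν, a₀, b, hb, hrefl⟩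
  have hEm := hE.measurableSet
  by_cases hpos : volume E = 0
  · rw [eq_empty_of_volume_eq_zero hEm hpos h0, measure_empty]
  have hνE : Integrable (fun t : ℝ => (t ^ 2 + 1)⁻¹) (ν.restrict E) := hν.restrict
  have hνEc : Integrable (fun t : ℝ => (t ^ 2 + 1)⁻¹) (ν.restrict Eᶜ) := hν.restrict
  have hf₀ := isFiniteMeasure_circleMeasure 0 hνE
  have hf₁ := isFiniteMeasure_circleMeasure b hνEc
  set ρ₀ := circleMeasure (ν.restrict E) 0 with hρ₀
  have h₀ : ArgIneq E a₀ (ρ₀ + circleMeasure (ν.restrict Eᶜ) b) := by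
    rw [argIneq_iff hEm]
    filter_upwards [hrefl] with t ht
    refine ht.congr' ?_
    filter_upwards [self_mem_nhdsWithin] with y hy
    rw [herglotzFn_eq_HF_add hν hEm a₀ hb (by simpa using hy)]
  obtain ⟨a, σ, hσf, hσ, hσE⟩ := exists_argIneq_of_compl_null hE hpos ρ₀ _ h₀
  set ρ := ρ₀ + σ with hρ
  have hμ : Integrable (fun t : ℝ => (t ^ 2 + 1)⁻¹) (lineMeasure ρ) :=
    integrable_weight_lineMeasure ρ
  have hμR : IsReflectionless (lineMeasure ρ) E := by
    refine ⟨hμ, a, ρ.real {1}, measureReal_nonneg, ?_⟩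
    filter_upwards [(argIneq_iff hEm a ρ).mp hσ] with t ht
    refine ht.congr' ?_
    filter_upwards [self_mem_nhdsWithin] with y hy
    rw [herglotzFn_lineMeasure ρ a (by simpa using hy)]
  have hμE : lineMeasure ρ Eᶜ = 0 := by
    rw [lineMeasure_eq_zero_iff ρ hEm.compl, hρ, Measure.add_apply, hσE, add_zero, hρ₀,
      circleMeasure_circleSet_eq_zero_iff _ _ hEm.compl]
    simp [hEm.compl]
  have hlν := isLocallyFiniteMeasure_of_weight hν
  have hlμ := isLocallyFiniteMeasure_of_weight hμ
  refine singularPart_apply_eq_zero hEm (h0 _ hμR hμE) fun S hSE hS hS0 => ?_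
  rw [lineMeasure_eq_zero_iff ρ hS, hρ, Measure.add_apply] at hS0
  have h1 := (add_eq_zero.mp hS0).1
  rw [hρ₀, circleMeasure_circleSet_eq_zero_iff _ _ hS, Measure.restrict_apply hS,
    Set.inter_eq_left.mpr hSE] at h1
  exact h1
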